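/- arXiv:1712.04091 — 3 statements merged into one kernel-verified Lean document; each statement's English description precedes it below -/
import Mathlib

section
/- Let u be an ancient solution of the heat equation on ℝⁿ with polynomial growth of degree at most q ≥ 1, i.e. |u(x,t)| ≤ c₀(|x| + √|t| + 1)^q for all x ∈ ℝⁿ, t ≤ 0. Then u extends to an eternal solution: there exists a smooth function ũ : ℝⁿ × ℝ → ℝ satisfying Δ_x ũ = ∂_t ũ on all of ℝⁿ × ℝ, with ũ(x,t) = u(x,t) for t ≤ 0, and there is a constant C such that |ũ(x,t)| ≤ C(|x| + √|t| + 1)^q for all (x,t) ∈ ℝⁿ × ℝ. -/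
open MeasureTheory Real

noncomputable section

/-- Spatial Laplacian of `f : ℝⁿ → ℝ` at `x` (sum of second partial derivatives). -/
def lap (n : ℕ) (f : EuclideanSpace ℝ (Fin n) → ℝ) (x : EuclideanSpace ℝ (Fin n)) : ℝ :=
  ∑ i : Fin n, fderiv ℝ (fun y => fderiv ℝ f y (EuclideanSpace.single i 1)) x
    (EuclideanSpace.single i 1)

/-- `u` is a smooth ancient solution of the heat equation on `ℝⁿ × (-∞, 0]`:
it is smooth and satisfies `Δ_x u = ∂_t u` for all `t ≤ 0`. -/
def IsAncientHeat (n : ℕ) (u : EuclideanSpace ℝ (Fin n) × ℝ → ℝ) : Prop :=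
  ContDiff ℝ (⊤ : ℕ∞) u ∧ ∀ (x : EuclideanSpace ℝ (Fin n)) (t : ℝ), t ≤ 0 →
    lap n (fun y => u (y, t)) x = deriv (fun s => u (x, s)) t

section DirectionalDerivatives

variable {X : Type*} [NormedAddCommGroup X] [NormedSpace ℝ X]

/-- The directional derivative of `f` in the direction `v`. -/
def dirD (v : X) (f : X → ℝ) : X → ℝ := fun p => fderiv ℝ f p v

lemma ContDiff.dirD {f : X → ℝ} (hf : ContDiff ℝ (⊤ : ℕ∞) f) (v : X) :
    ContDiff ℝ (⊤ : ℕ∞) (dirD v f) :=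
  (hf.fderiv_right (m := (⊤ : ℕ∞)) (by simp)).clm_apply contDiff_const

lemma ContDiff.differentiableAt_of_top {f : X → ℝ} (hf : ContDiff ℝ (⊤ : ℕ∞) f) (p : X) :
    DifferentiableAt ℝ f p :=
  (hf.differentiable (by simp)) p

lemma ContDiff.dirD_iterate {f : X → ℝ} (hf : ContDiff ℝ (⊤ : ℕ∞) f) (v : X) (k : ℕ) :
    ContDiff ℝ (⊤ : ℕ∞) ((_root_.dirD v)^[k] f) := by
  induction k with
  | zero => exact hf
  | succ k ih => rw [Function.iterate_succ_apply']; exact ih.dirD v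

lemma dirD_mul {f g : X → ℝ} (hf : ContDiff ℝ (⊤ : ℕ∞) f) (hg : ContDiff ℝ (⊤ : ℕ∞) g)
    (v p : X) :
    dirD v (fun y => f y * g y) p = f p * dirD v g p + g p * dirD v f p := by
  simp only [dirD]
  rw [fderiv_fun_mul (hf.differentiableAt_of_top p) (hg.differentiableAt_of_top p)]
  simp

lemma dirD_pow {f : X → ℝ} (hf : ContDiff ℝ (⊤ : ℕ∞) f) (m : ℕ) (v p : X) :
    dirD v (fun y => f y ^ (m + 1)) p = (m + 1) * f p ^ m * dirD v f p := by
  simp only [dirD]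
  rw [fderiv_fun_pow _ (hf.differentiableAt_of_top p)]
  simp

lemma dirD_sum {ι : Type*} (s : Finset ι) {f : ι → X → ℝ}
    (hf : ∀ i, ContDiff ℝ (⊤ : ℕ∞) (f i)) (v p : X) :
    dirD v (fun y => ∑ i ∈ s, f i y) p = ∑ i ∈ s, dirD v (f i) p := by
  simp only [dirD]
  rw [fderiv_fun_sum fun i _ => (hf i).differentiableAt_of_top p]
  simp

lemma dirD_comm {f : X → ℝ} (hf : ContDiff ℝ (⊤ : ℕ∞) f) (v w : X) :
    dirD v (dirD w f) = dirD w (dirD v f) := by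
  funext p
  have hd : DifferentiableAt ℝ (fderiv ℝ f) p :=
    ((hf.fderiv_right (m := (⊤ : ℕ∞)) (by simp)).differentiable (by simp)) p
  have h : IsSymmSndFDerivAt ℝ f p :=
    hf.contDiffAt.isSymmSndFDerivAt
      (by simpa using WithTop.coe_le_coe.2 (le_top (a := (2 : ℕ∞))))
  have key : ∀ a b : X, dirD a (dirD b f) p = fderiv ℝ (fderiv ℝ f) p a b := fun a b => by
    change fderiv ℝ (fun y => fderiv ℝ f y b) p a = _
    rw [fderiv_clm_apply hd (differentiableAt_const b)]
    simp
  rw [key, key, h.eq]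

lemma dirD_congr_of_isOpen {f g : X → ℝ} {U : Set X} (hU : IsOpen U) (h : ∀ p ∈ U, f p = g p)
    (v : X) {p : X} (hp : p ∈ U) : dirD v f p = dirD v g p := by
  have : f =ᶠ[nhds p] g := Filter.eventually_of_mem (hU.mem_nhds hp) h
  simp only [dirD, this.fderiv_eq]

lemma HasCompactSupport.dirD {f : X → ℝ} (hf : HasCompactSupport f) (v : X) :
    HasCompactSupport (dirD v f) :=
  hf.fderiv_apply ℝ v

lemma integral_dirD_eq_zero [FiniteDimensional ℝ X] [MeasurableSpace X] [BorelSpace X]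
    (μ : Measure X) [μ.IsAddHaarMeasure] {f : X → ℝ} (hf : ContDiff ℝ (⊤ : ℕ∞) f)
    (hs : HasCompactSupport f) (v : X) : ∫ p, dirD v f p ∂μ = 0 := by
  have hi : Integrable (dirD v f) μ :=
    (hf.dirD v).continuous.integrable_of_hasCompactSupport (hs.dirD v)
  have hi' : Integrable f μ := hf.continuous.integrable_of_hasCompactSupport hs
  have := integral_mul_fderiv_eq_neg_fderiv_mul_of_integrable (μ := μ) (𝕜 := ℝ)
    (f := fun _ : X => (1 : ℝ)) (g := f) (v := v) (by simp)
    (by simp only [one_mul]; exact hi)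
    (by simpa using hi') (by simp) (fun x _ => hf.differentiableAt_of_top x)
  simpa [_root_.dirD] using this

end DirectionalDerivatives

section Energy

variable {X ι : Type*} [NormedAddCommGroup X] [NormedSpace ℝ X] [Fintype ι]

lemma caccioppoli_gradient_pointwise (a : ℕ) {K f s W : ℝ} {Y Z : ι → ℝ}
    (hf : 0 ≤ f) (hZ : ∑ i, Z i ^ 2 ≤ K) (hs : f * s ≤ K) :
    1 / 2 * f ^ (a + 2) * ∑ i, Y i ^ 2 - (a + 2) ^ 2 * K * f ^ a * W ^ 2 ≤
      f ^ (a + 2) * ∑ i, Y i ^ 2 + (a + 2) * f ^ (a + 1) * W * ∑ i, Z i * Y i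
        - (a + 2) / 2 * f ^ (a + 1) * s * W ^ 2 := by
  have hK : 0 ≤ K := (Finset.sum_nonneg fun i _ => sq_nonneg (Z i)).trans hZ
  have h1 : 0 ≤ ∑ i, (f * Y i + (a + 2) * W * Z i) ^ 2 :=
    Finset.sum_nonneg fun i _ => sq_nonneg _
  have h2 : ∑ i, (f * Y i + (a + 2) * W * Z i) ^ 2 =
      f ^ 2 * ∑ i, Y i ^ 2 + 2 * ((a + 2) * f * W * ∑ i, Z i * Y i)
        + ((a + 2) * W) ^ 2 * ∑ i, Z i ^ 2 := by
    simp only [Finset.mul_sum, ← Finset.sum_add_distrib]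
    exact Finset.sum_congr rfl fun i _ => by ring
  have h3 : ((a + 2) * W) ^ 2 * ∑ i, Z i ^ 2 ≤ ((a + 2) * W) ^ 2 * K := by gcongr
  have h4 : (a + 2) * W ^ 2 * (f * s) ≤ (a + 2) * W ^ 2 * K := by gcongr
  have ha : (0 : ℝ) ≤ a := a.cast_nonneg
  have h5 : (a + 2) * W ^ 2 * K ≤ (a + 2) ^ 2 * W ^ 2 * K := by
    gcongr
    nlinarith
  have h6 : 0 ≤ f ^ 2 * ∑ i, Y i ^ 2 + (a + 2) * f * W * ∑ i, Z i * Y i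
      - (a + 2) / 2 * (f * s) * W ^ 2
      - (1 / 2 * f ^ 2 * ∑ i, Y i ^ 2 - (a + 2) ^ 2 * K * W ^ 2) := by
    nlinarith
  have h7 := mul_nonneg (pow_nonneg hf a) h6
  have e2 : f ^ (a + 2) = f ^ a * f ^ 2 := pow_add _ _ _
  have e1 : f ^ (a + 1) = f ^ a * f := pow_succ _ _
  rw [e1, e2]
  linarith

lemma caccioppoli_time_pointwise (a : ℕ) {K f s T : ℝ} {Y Z : ι → ℝ}
    (hf : 0 ≤ f) (hZ : ∑ i, Z i ^ 2 ≤ K) (hs : f * s ≤ K) :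
    1 / 2 * f ^ (a + 2) * T ^ 2 - (a + 2) ^ 2 * K * f ^ a * ∑ i, Y i ^ 2 ≤
      f ^ (a + 2) * T ^ 2 + (a + 2) * f ^ (a + 1) * T * ∑ i, Z i * Y i
        - (a + 2) / 2 * f ^ (a + 1) * s * ∑ i, Y i ^ 2 := by
  have hK : 0 ≤ K := (Finset.sum_nonneg fun i _ => sq_nonneg (Z i)).trans hZ
  have hY : 0 ≤ ∑ i, Y i ^ 2 := Finset.sum_nonneg fun i _ => sq_nonneg (Y i)
  have h1 := sq_nonneg (f * T + (a + 2) * ∑ i, Z i * Y i)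
  have h2 : (∑ i, Z i * Y i) ^ 2 ≤ K * ∑ i, Y i ^ 2 :=
    (Finset.sum_mul_sq_le_sq_mul_sq _ _ _).trans (by gcongr)
  have ha : (0 : ℝ) ≤ a := a.cast_nonneg
  have h3 : ((a : ℝ) + 2) ^ 2 * (∑ i, Z i * Y i) ^ 2 ≤ (a + 2) ^ 2 * (K * ∑ i, Y i ^ 2) := by
    gcongr
  have h4 : (a + 2) * (∑ i, Y i ^ 2) * (f * s) ≤ (a + 2) * (∑ i, Y i ^ 2) * K := by gcongr
  have h5 : (a + 2) * (∑ i, Y i ^ 2) * K ≤ (a + 2) ^ 2 * (∑ i, Y i ^ 2) * K := by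
    gcongr
    nlinarith
  have h6 : 0 ≤ f ^ 2 * T ^ 2 + (a + 2) * f * T * ∑ i, Z i * Y i
      - (a + 2) / 2 * (f * s) * ∑ i, Y i ^ 2
      - (1 / 2 * f ^ 2 * T ^ 2 - (a + 2) ^ 2 * K * ∑ i, Y i ^ 2) := by
    nlinarith
  have h7 := mul_nonneg (pow_nonneg hf a) h6
  have e2 : f ^ (a + 2) = f ^ a * f ^ 2 := pow_add _ _ _
  have e1 : f ^ (a + 1) = f ^ a * f := pow_succ _ _
  rw [e1, e2]
  linarith

lemma HasCompactSupport.pow_mul {Y : Type*} [TopologicalSpace Y] {φ g : Y → ℝ} (hs : HasCompactSupport φ) (m : ℕ) :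
    HasCompactSupport fun p => φ p ^ (m + 1) * g p := by
  have : (fun p => φ p ^ (m + 1) * g p) = φ * fun p => φ p ^ m * g p := by
    funext p
    simp only [Pi.mul_apply]
    ring
  rw [this]
  exact hs.mul_right

lemma heat_dirD_iterate {e : ι → X} {τ : X} {w : X → ℝ} {U : Set X} (hU : IsOpen U) (hw : ContDiff ℝ (⊤ : ℕ∞) w)
    (heat : ∀ p ∈ U, ∑ i, dirD (e i) (dirD (e i) w) p = dirD τ w p) (k : ℕ) :
    ∀ p ∈ U, ∑ i, dirD (e i) (dirD (e i) ((dirD τ)^[k] w)) p = dirD τ ((dirD τ)^[k] w) p := by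
  induction k with
  | zero => exact heat
  | succ k ih =>
    intro p hp
    have hk := hw.dirD_iterate τ k
    have h := dirD_congr_of_isOpen hU ih τ hp
    rw [dirD_sum _ fun i => (hk.dirD (e i)).dirD (e i)] at h
    rw [Function.iterate_succ_apply', ← h]
    refine Finset.sum_congr rfl fun i _ => ?_
    rw [dirD_comm hk (e i) τ, dirD_comm (hk.dirD (e i)) (e i) τ]

lemma integrable_pow_mul [MeasurableSpace X] [BorelSpace X] (μ : Measure X)
    [IsFiniteMeasureOnCompacts μ] {φ g : X → ℝ} (hφ : ContDiff ℝ (⊤ : ℕ∞) φ) (hs : HasCompactSupport φ)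
    (hg : Continuous g) (m : ℕ) : Integrable (fun p => φ p ^ (m + 1) * g p) μ :=
  ((hφ.continuous.pow _).mul hg).integrable_of_hasCompactSupport (hs.pow_mul m)

variable [FiniteDimensional ℝ X] [MeasurableSpace X] [BorelSpace X]
  (μ : Measure X) [μ.IsAddHaarMeasure] {e : ι → X} {τ : X} {φ w : X → ℝ} {K : ℝ}

lemma integral_divergence_eq_zero {G : ι → X → ℝ} {H : X → ℝ}
    (hφ : ContDiff ℝ (⊤ : ℕ∞) φ) (hs : HasCompactSupport φ)
    (hG : ∀ i, ContDiff ℝ (⊤ : ℕ∞) (G i)) (hH : ContDiff ℝ (⊤ : ℕ∞) H) (m : ℕ) :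
    Integrable (fun p => ∑ i, dirD (e i) (fun y => φ y ^ (m + 1) * G i y) p
      - 1 / 2 * dirD τ (fun y => φ y ^ (m + 1) * H y) p) μ ∧
    ∫ p, (∑ i, dirD (e i) (fun y => φ y ^ (m + 1) * G i y) p
      - 1 / 2 * dirD τ (fun y => φ y ^ (m + 1) * H y) p) ∂μ = 0 := by
  have hGs : ∀ i, ContDiff ℝ (⊤ : ℕ∞) (fun y => φ y ^ (m + 1) * G i y) := fun i =>
    (hφ.pow _).mul (hG i)
  have hHs : ContDiff ℝ (⊤ : ℕ∞) (fun y => φ y ^ (m + 1) * H y) := (hφ.pow _).mul hH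
  have iG : ∀ i, Integrable (dirD (e i) (fun y => φ y ^ (m + 1) * G i y)) μ := fun i =>
    ((hGs i).dirD _).continuous.integrable_of_hasCompactSupport ((hs.pow_mul m).dirD _)
  have iH : Integrable (dirD τ (fun y => φ y ^ (m + 1) * H y)) μ :=
    (hHs.dirD _).continuous.integrable_of_hasCompactSupport ((hs.pow_mul m).dirD _)
  have iS := integrable_finsetSum Finset.univ fun i _ => iG i
  refine ⟨iS.sub (iH.const_mul _), ?_⟩
  rw [integral_sub iS (iH.const_mul _), integral_finsetSum _ fun i _ => iG i,
    integral_const_mul, integral_dirD_eq_zero μ hHs (hs.pow_mul m)]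
  simp [fun i => integral_dirD_eq_zero μ (hGs i) (hs.pow_mul m) (e i)]

lemma caccioppoli_gradient (hφ : ContDiff ℝ (⊤ : ℕ∞) φ) (hs : HasCompactSupport φ)
    (hw : ContDiff ℝ (⊤ : ℕ∞) w) (h0 : ∀ p, 0 ≤ φ p)
    (hK : ∀ p, ∑ i, dirD (e i) φ p ^ 2 ≤ K) (hK' : ∀ p, φ p * dirD τ φ p ≤ K)
    (heat : ∀ p, φ p ≠ 0 → ∑ i, dirD (e i) (dirD (e i) w) p = dirD τ w p)
    {a : ℕ} (ha : a ≠ 0) :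
    ∫ p, φ p ^ (a + 2) * ∑ i, dirD (e i) w p ^ 2 ∂μ ≤
      2 * (a + 2) ^ 2 * K * ∫ p, φ p ^ a * w p ^ 2 ∂μ := by
  have hD := fun i => hw.dirD (e i)
  obtain ⟨hi, hz⟩ := integral_divergence_eq_zero μ (e := e) (τ := τ)
    (G := fun i y => w y * dirD (e i) w y) (H := fun y => w y ^ 2) hφ hs
    (fun i => hw.mul (hD i)) (hw.pow 2) (a + 1)
  have i1 : Integrable (fun p => φ p ^ (a + 2) * ∑ i, dirD (e i) w p ^ 2) μ :=
    integrable_pow_mul μ hφ hs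
      (continuous_finsetSum _ fun i _ => (hD i).continuous.pow 2) (a + 1)
  have i2 : Integrable (fun p => φ p ^ a * w p ^ 2) μ := by
    obtain ⟨b, rfl⟩ := Nat.exists_eq_succ_of_ne_zero ha
    exact integrable_pow_mul μ hφ hs (hw.continuous.pow 2) b
  have hle := integral_mono ((i1.const_mul (1 / 2)).sub (i2.const_mul ((a + 2) ^ 2 * K))) hi
    (fun p => by
      have h := caccioppoli_gradient_pointwise a (W := w p) (Y := fun i => dirD (e i) w p)
        (h0 p) (hK p) (hK' p)
      have hp : φ p ^ (a + 2) * ∑ i, dirD (e i) (dirD (e i) w) p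
          = φ p ^ (a + 2) * dirD τ w p := by
        by_cases hp : φ p = 0
        · simp [hp]
        · rw [heat p hp]
      have e1 : ∀ i, dirD (e i) (fun y => φ y ^ (a + 1 + 1) * (w y * dirD (e i) w y)) p =
          φ p ^ (a + 2) * dirD (e i) w p ^ 2
          + w p * (φ p ^ (a + 2) * dirD (e i) (dirD (e i) w) p)
          + (a + 2) * φ p ^ (a + 1) * w p * (dirD (e i) φ p * dirD (e i) w p) := fun i => by
        rw [dirD_mul (hφ.pow _) (hw.mul (hD i)), dirD_mul hw (hD i), dirD_pow hφ]
        push_cast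
        ring
      have e2 : dirD τ (fun y => φ y ^ (a + 1 + 1) * w y ^ 2) p =
          φ p ^ (a + 2) * (2 * w p * dirD τ w p)
          + (a + 2) * φ p ^ (a + 1) * dirD τ φ p * w p ^ 2 := by
        rw [dirD_mul (hφ.pow _) (hw.pow 2), dirD_pow hφ, dirD_pow hw 1]
        push_cast
        ring
      simp only [e1, e2, Finset.sum_add_distrib, ← Finset.mul_sum, hp, Pi.sub_apply]
      linarith)
  rw [hz, integral_sub' (i1.const_mul _) (i2.const_mul _), integral_const_mul,
    integral_const_mul] at hle
  linarith

lemma caccioppoli_time (hφ : ContDiff ℝ (⊤ : ℕ∞) φ) (hs : HasCompactSupport φ)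
    (hw : ContDiff ℝ (⊤ : ℕ∞) w) (h0 : ∀ p, 0 ≤ φ p)
    (hK : ∀ p, ∑ i, dirD (e i) φ p ^ 2 ≤ K) (hK' : ∀ p, φ p * dirD τ φ p ≤ K)
    (heat : ∀ p, φ p ≠ 0 → ∑ i, dirD (e i) (dirD (e i) w) p = dirD τ w p)
    {a : ℕ} (ha : a ≠ 0) :
    ∫ p, φ p ^ (a + 2) * dirD τ w p ^ 2 ∂μ ≤
      2 * (a + 2) ^ 2 * K * ∫ p, φ p ^ a * ∑ i, dirD (e i) w p ^ 2 ∂μ := by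
  have hD := fun i => hw.dirD (e i)
  have hT := hw.dirD τ
  have hS : ContDiff ℝ (⊤ : ℕ∞) (fun y => ∑ i, dirD (e i) w y ^ 2) :=
    ContDiff.sum fun i _ => (hD i).pow 2
  obtain ⟨hi, hz⟩ := integral_divergence_eq_zero μ (e := e) (τ := τ)
    (G := fun i y => dirD τ w y * dirD (e i) w y) (H := fun y => ∑ i, dirD (e i) w y ^ 2) hφ hs
    (fun i => hT.mul (hD i)) hS (a + 1)
  have i1 : Integrable (fun p => φ p ^ (a + 2) * dirD τ w p ^ 2) μ :=
    integrable_pow_mul μ hφ hs (hT.continuous.pow 2) (a + 1)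
  have i2 : Integrable (fun p => φ p ^ a * ∑ i, dirD (e i) w p ^ 2) μ := by
    obtain ⟨b, rfl⟩ := Nat.exists_eq_succ_of_ne_zero ha
    exact integrable_pow_mul μ hφ hs hS.continuous b
  have hle := integral_mono ((i1.const_mul (1 / 2)).sub (i2.const_mul ((a + 2) ^ 2 * K))) hi
    (fun p => by
      have h := caccioppoli_time_pointwise a (T := dirD τ w p) (Y := fun i => dirD (e i) w p)
        (h0 p) (hK p) (hK' p)
      have hp : φ p ^ (a + 2) * ∑ i, dirD (e i) (dirD (e i) w) p
          = φ p ^ (a + 2) * dirD τ w p := by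
        by_cases hp : φ p = 0
        · simp [hp]
        · rw [heat p hp]
      have e1 : ∀ i, dirD (e i) (fun y => φ y ^ (a + 1 + 1) * (dirD τ w y * dirD (e i) w y)) p =
          φ p ^ (a + 2) * (dirD (e i) w p * dirD τ (dirD (e i) w) p)
          + dirD τ w p * (φ p ^ (a + 2) * dirD (e i) (dirD (e i) w) p)
          + (a + 2) * φ p ^ (a + 1) * dirD τ w p * (dirD (e i) φ p * dirD (e i) w p) := fun i => by
        rw [dirD_mul (hφ.pow _) (hT.mul (hD i)), dirD_mul hT (hD i), dirD_pow hφ,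
          dirD_comm hw (e i) τ]
        push_cast
        ring
      have e3 : ∀ i, dirD τ (fun y => dirD (e i) w y ^ 2) p =
          2 * (dirD (e i) w p * dirD τ (dirD (e i) w) p) := fun i => by
        rw [dirD_pow (hD i) 1]
        push_cast
        ring
      have e2 : dirD τ (fun y => φ y ^ (a + 1 + 1) * ∑ i, dirD (e i) w y ^ 2) p =
          2 * (φ p ^ (a + 2) * ∑ i, dirD (e i) w p * dirD τ (dirD (e i) w) p)
          + (a + 2) * φ p ^ (a + 1) * dirD τ φ p * ∑ i, dirD (e i) w p ^ 2 := by
        rw [dirD_mul (hφ.pow _) hS, dirD_pow hφ, dirD_sum _ fun i => (hD i).pow 2]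
        simp only [e3, ← Finset.mul_sum]
        push_cast
        ring
      simp only [e1, e2, Finset.sum_add_distrib, ← Finset.mul_sum, hp, Pi.sub_apply]
      linarith)
  rw [hz, integral_sub' (i1.const_mul _) (i2.const_mul _), integral_const_mul,
    integral_const_mul] at hle
  linarith

lemma caccioppoli_iterate {U : Set X} (hU : IsOpen U) (hw : ContDiff ℝ (⊤ : ℕ∞) w)
    (heat : ∀ p ∈ U, ∑ i, dirD (e i) (dirD (e i) w) p = dirD τ w p) (k : ℕ) :
    ∃ C : ℝ, 0 ≤ C ∧ ∀ (K : ℝ) (φ : X → ℝ), ContDiff ℝ (⊤ : ℕ∞) φ → HasCompactSupport φ →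
      (∀ p, 0 ≤ φ p) → (∀ p, ∑ i, dirD (e i) φ p ^ 2 ≤ K) → (∀ p, φ p * dirD τ φ p ≤ K) →
      (∀ p, φ p ≠ 0 → p ∈ U) →
      ∫ p, φ p ^ (4 * k + 2) * (dirD τ)^[k] w p ^ 2 ∂μ ≤
        C * K ^ (2 * k) * ∫ p, φ p ^ 2 * w p ^ 2 ∂μ := by
  induction k with
  | zero => exact ⟨1, zero_le_one, fun K φ _ _ _ _ _ _ => by simp⟩
  | succ k ih =>
    obtain ⟨C, hC, h⟩ := ih
    set a : ℕ := 4 * k + 2 with ha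
    refine ⟨2 * (a + 2 + 2) ^ 2 * (2 * (a + 2) ^ 2) * C, by positivity, ?_⟩
    intro K φ hφ hs h0 hK hK' hφU
    have hKn : 0 ≤ K := (Finset.sum_nonneg fun i _ => sq_nonneg _).trans (hK 0)
    have hk := hw.dirD_iterate τ k
    have hheat : ∀ p, φ p ≠ 0 → ∑ i, dirD (e i) (dirD (e i) ((dirD τ)^[k] w)) p
        = dirD τ ((dirD τ)^[k] w) p := fun p hp =>
      heat_dirD_iterate hU hw heat k p (hφU p hp)
    have h1 := h K φ hφ hs h0 hK hK' hφU
    have h2 := caccioppoli_gradient μ hφ hs hk h0 hK hK' hheat (a := a) (by lia)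
    have h3 := caccioppoli_time μ hφ hs hk h0 hK hK' hheat (a := a + 2) (by lia)
    rw [show 4 * (k + 1) + 2 = a + 2 + 2 by lia, show 2 * (k + 1) = 2 * k + 2 by lia,
      Function.iterate_succ_apply']
    push_cast at h3
    calc _ ≤ _ := h3
      _ ≤ 2 * (a + 2 + 2) ^ 2 * K * (2 * (a + 2) ^ 2 * K *
          (C * K ^ (2 * k) * ∫ p, φ p ^ 2 * w p ^ 2 ∂μ)) := by
        gcongr
        exact h2.trans (by gcongr)
      _ = _ := by ring

end Energy

section Cutoff

lemma deriv_smoothTransition_eq_zero_of_neg {x : ℝ} (hx : x < 0) :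
    deriv smoothTransition x = 0 := by
  have h : smoothTransition =ᶠ[nhds x] fun _ => 0 :=
    Filter.eventually_of_mem (Iio_mem_nhds hx) fun y hy =>
      smoothTransition.zero_of_nonpos (le_of_lt hy)
  rw [h.deriv_eq, deriv_const]

lemma deriv_smoothTransition_eq_zero_of_one_lt {x : ℝ} (hx : 1 < x) :
    deriv smoothTransition x = 0 := by
  have h : smoothTransition =ᶠ[nhds x] fun _ => 1 :=
    Filter.eventually_of_mem (Ioi_mem_nhds hx) fun y hy =>
      smoothTransition.one_of_one_le (le_of_lt hy)
  rw [h.deriv_eq, deriv_const]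

lemma exists_deriv_smoothTransition_bound :
    ∃ A : ℝ, 0 ≤ A ∧ ∀ x, |deriv smoothTransition x| ≤ A := by
  have hc : Continuous (deriv smoothTransition) :=
    (smoothTransition.contDiff (n := 1)).continuous_deriv (by simp)
  obtain ⟨A, hA⟩ := hc.bounded_above_of_compact_support
    (HasCompactSupport.intro (isCompact_Icc (a := (0 : ℝ)) (b := 1)) fun x hx => by
      rw [Set.mem_Icc, not_and_or, not_le, not_le] at hx
      exact hx.elim deriv_smoothTransition_eq_zero_of_neg deriv_smoothTransition_eq_zero_of_one_lt)
  exact ⟨A, (norm_nonneg _).trans (hA 0), hA⟩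

variable {n : ℕ}

/-- A cutoff adapted to the parabolic cylinder of radius `R`, supported in `t ≤ 0`. -/
def heatCutoff (n : ℕ) (R : ℝ) (p : EuclideanSpace ℝ (Fin n) × ℝ) : ℝ :=
  smoothTransition (2 - ‖p.1‖ ^ 2 / R ^ 2) *
    (smoothTransition (p.2 / R ^ 2 + 2) * smoothTransition (-p.2))

lemma contDiff_heatCutoff (R : ℝ) : ContDiff ℝ (⊤ : ℕ∞) (heatCutoff n R) := by
  have h1 : ContDiff ℝ (⊤ : ℕ∞) fun p : EuclideanSpace ℝ (Fin n) × ℝ =>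
      2 - ‖p.1‖ ^ 2 / R ^ 2 :=
    contDiff_const.sub ((contDiff_fst.norm_sq ℝ).div_const _)
  have h2 : ContDiff ℝ (⊤ : ℕ∞) fun p : EuclideanSpace ℝ (Fin n) × ℝ => p.2 / R ^ 2 + 2 :=
    (contDiff_snd.div_const _).add contDiff_const
  have h3 : ContDiff ℝ (⊤ : ℕ∞) fun p : EuclideanSpace ℝ (Fin n) × ℝ => -p.2 :=
    contDiff_snd.neg
  exact (smoothTransition.contDiff.comp h1).mul
    ((smoothTransition.contDiff.comp h2).mul (smoothTransition.contDiff.comp h3))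

lemma heatCutoff_nonneg (R : ℝ) (p : EuclideanSpace ℝ (Fin n) × ℝ) : 0 ≤ heatCutoff n R p :=
  mul_nonneg (smoothTransition.nonneg _)
    (mul_nonneg (smoothTransition.nonneg _) (smoothTransition.nonneg _))

lemma heatCutoff_le_one (R : ℝ) (p : EuclideanSpace ℝ (Fin n) × ℝ) : heatCutoff n R p ≤ 1 :=
  mul_le_one₀ (smoothTransition.le_one _)
    (mul_nonneg (smoothTransition.nonneg _) (smoothTransition.nonneg _))
    (mul_le_one₀ (smoothTransition.le_one _) (smoothTransition.nonneg _)
      (smoothTransition.le_one _))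

lemma heatCutoff_support {R : ℝ} (hR : 0 < R) {p : EuclideanSpace ℝ (Fin n) × ℝ}
    (hp : heatCutoff n R p ≠ 0) : ‖p.1‖ ≤ 2 * R ∧ -(2 * R ^ 2) ≤ p.2 ∧ p.2 < 0 := by
  simp only [heatCutoff, mul_ne_zero_iff, Ne, smoothTransition.zero_iff_nonpos, not_le] at hp
  obtain ⟨h1, h2, h3⟩ := hp
  refine ⟨?_, ?_, by linarith⟩
  · have : ‖p.1‖ ^ 2 < 2 * R ^ 2 := by
      rwa [sub_pos, div_lt_iff₀ (by positivity)] at h1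
    exact (abs_le_of_sq_le_sq' (by nlinarith) (by positivity)).2
  · have : -2 < p.2 / R ^ 2 := by linarith
    rw [lt_div_iff₀ (by positivity)] at this
    linarith

lemma heatCutoff_mem_closedBall {R : ℝ} (hR : 1 ≤ R) {p : EuclideanSpace ℝ (Fin n) × ℝ}
    (hp : heatCutoff n R p ≠ 0) : p ∈ Metric.closedBall 0 (2 * R ^ 2) := by
  obtain ⟨h1, h2, h3⟩ := heatCutoff_support (by linarith) hp
  rw [mem_closedBall_zero_iff, Prod.norm_def, max_le_iff, Real.norm_eq_abs, abs_le]
  refine ⟨h1.trans (by nlinarith), by linarith, by nlinarith⟩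

lemma hasCompactSupport_heatCutoff {R : ℝ} (hR : 1 ≤ R) :
    HasCompactSupport (heatCutoff n R) :=
  HasCompactSupport.intro (isCompact_closedBall 0 (2 * R ^ 2)) fun _ hp =>
    not_not.1 fun h => hp (heatCutoff_mem_closedBall hR h)

lemma heatCutoff_mono {R R' : ℝ} (hR : 0 < R) (h : R ≤ R')
    (p : EuclideanSpace ℝ (Fin n) × ℝ) : heatCutoff n R p ≤ heatCutoff n R' p := by
  by_cases hp : heatCutoff n R p = 0
  · rw [hp]
    exact heatCutoff_nonneg _ _
  have ht := (heatCutoff_support hR hp).2.2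
  have hdiv : -p.2 / R' ^ 2 ≤ -p.2 / R ^ 2 := by
    have := ht.le
    gcongr
    linarith
  rw [neg_div, neg_div, neg_le_neg_iff] at hdiv
  have h1 : smoothTransition (2 - ‖p.1‖ ^ 2 / R ^ 2) ≤
      smoothTransition (2 - ‖p.1‖ ^ 2 / R' ^ 2) := smoothTransition.monotone (by gcongr)
  have h2 : smoothTransition (p.2 / R ^ 2 + 2) ≤ smoothTransition (p.2 / R' ^ 2 + 2) :=
    smoothTransition.monotone (by gcongr)
  unfold heatCutoff
  gcongr
  all_goals
    first
    | exact smoothTransition.nonneg _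
    | exact mul_nonneg (smoothTransition.nonneg _) (smoothTransition.nonneg _)

lemma exists_heatCutoff_pos {p : EuclideanSpace ℝ (Fin n) × ℝ} (hp : p.2 < 0) :
    ∃ R : ℝ, 1 ≤ R ∧ heatCutoff n R p ≠ 0 := by
  set R := 1 + ‖p.1‖ + |p.2| with hRdef
  have hx := norm_nonneg p.1
  have ht := abs_nonneg p.2
  have hR : 1 ≤ R := by linarith
  have hR2 : 0 < R ^ 2 := by positivity
  refine ⟨R, hR, ?_⟩
  simp only [heatCutoff, mul_ne_zero_iff, Ne, smoothTransition.zero_iff_nonpos, not_le]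
  refine ⟨?_, ?_, by linarith⟩
  · rw [sub_pos, div_lt_iff₀ hR2]
    nlinarith
  · have : -2 < p.2 / R ^ 2 := by
      rw [lt_div_iff₀ hR2]
      have := neg_abs_le p.2
      nlinarith
    linarith

lemma HasFDerivAt.smoothTransition_comp {X : Type*} [NormedAddCommGroup X] [NormedSpace ℝ X]
    {g : X → ℝ} {g' : X →L[ℝ] ℝ} {p : X} (hg : HasFDerivAt g g' p) :
    HasFDerivAt (fun y => smoothTransition (g y)) (deriv smoothTransition (g p) • g') p :=
  ((smoothTransition.contDiff (n := 1)).differentiable (by simp) (g p)).hasDerivAt.comp_hasFDerivAt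
    p hg

lemma dirD_heatCutoff (R : ℝ) (w p : EuclideanSpace ℝ (Fin n) × ℝ) :
    dirD w (heatCutoff n R) p =
      -(deriv smoothTransition (2 - ‖p.1‖ ^ 2 / R ^ 2) * (2 * inner ℝ p.1 w.1 / R ^ 2)) *
        (smoothTransition (p.2 / R ^ 2 + 2) * smoothTransition (-p.2)) +
      smoothTransition (2 - ‖p.1‖ ^ 2 / R ^ 2) *
        (deriv smoothTransition (p.2 / R ^ 2 + 2) * (w.2 / R ^ 2) * smoothTransition (-p.2)
          - smoothTransition (p.2 / R ^ 2 + 2) * (deriv smoothTransition (-p.2) * w.2)) := by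
  have h1 := ((((hasFDerivAt_fst (𝕜 := ℝ) (p := p)).norm_sq).mul_const
    (R ^ 2)⁻¹).const_sub 2).smoothTransition_comp
  have h2 := (((hasFDerivAt_snd (𝕜 := ℝ) (p := p)).mul_const
    (R ^ 2)⁻¹).add_const 2).smoothTransition_comp
  have h3 := (hasFDerivAt_snd (𝕜 := ℝ) (p := p)).neg.smoothTransition_comp
  have h := h1.mul (h2.mul h3)
  have h' : HasFDerivAt (heatCutoff n R) _ p := h
  simp only [dirD, h'.fderiv]
  simp [div_eq_mul_inv]
  ring

lemma exists_heatCutoff_deriv_bound (n : ℕ) :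
    ∃ K : ℝ, 0 ≤ K ∧ ∀ R : ℝ, 1 ≤ R →
      (∀ p, ∑ i, dirD (EuclideanSpace.single i (1 : ℝ), (0 : ℝ)) (heatCutoff n R) p ^ 2
        ≤ K / R ^ 2) ∧
      ∀ p, heatCutoff n R p * dirD ((0 : EuclideanSpace ℝ (Fin n)), (1 : ℝ)) (heatCutoff n R) p
        ≤ K / R ^ 2 := by
  obtain ⟨A, hA0, hA⟩ := exists_deriv_smoothTransition_bound
  refine ⟨8 * A ^ 2 + A, by positivity, fun R hR => ⟨fun p => ?_, fun p => ?_⟩⟩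
  · have hR2 : 0 < R ^ 2 := by positivity
    set B := deriv smoothTransition (2 - ‖p.1‖ ^ 2 / R ^ 2) with hB
    set T := smoothTransition (p.2 / R ^ 2 + 2) * smoothTransition (-p.2) with hT
    have hT0 : 0 ≤ T := mul_nonneg (smoothTransition.nonneg _) (smoothTransition.nonneg _)
    have hT1 : T ≤ 1 := mul_le_one₀ (smoothTransition.le_one _) (smoothTransition.nonneg _)
      (smoothTransition.le_one _)
    have hTsq : T ^ 2 ≤ 1 := pow_le_one₀ hT0 hT1
    have hBA : B ^ 2 ≤ A ^ 2 := sq_le_sq' (neg_le_of_abs_le (hA _)) (le_of_abs_le (hA _))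
    have hsum : ∑ i, dirD (EuclideanSpace.single i (1 : ℝ), (0 : ℝ)) (heatCutoff n R) p ^ 2
        = (4 * T ^ 2 / R ^ 4) * (B ^ 2 * ‖p.1‖ ^ 2) := by
      rw [EuclideanSpace.norm_sq_eq, Finset.mul_sum, Finset.mul_sum]
      refine Finset.sum_congr rfl fun i _ => ?_
      rw [dirD_heatCutoff]
      simp [← hB, ← hT, EuclideanSpace.inner_single_right]
      field_simp
      ring
    have hBx : B ^ 2 * ‖p.1‖ ^ 2 ≤ A ^ 2 * (2 * R ^ 2) := by
      by_cases hx : ‖p.1‖ ^ 2 ≤ 2 * R ^ 2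
      · gcongr
      · have : B = 0 := deriv_smoothTransition_eq_zero_of_neg (by
          rw [sub_neg, lt_div_iff₀ hR2]
          linarith)
        rw [this, zero_pow two_ne_zero, zero_mul]
        positivity
    rw [hsum]
    calc _ ≤ (4 * 1 / R ^ 4) * (A ^ 2 * (2 * R ^ 2)) := by gcongr
      _ = 8 * A ^ 2 / R ^ 2 := by field_simp; ring
      _ ≤ _ := by gcongr; linarith
  · have hR2 : 0 < R ^ 2 := by positivity
    have h1 : dirD ((0 : EuclideanSpace ℝ (Fin n)), (1 : ℝ)) (heatCutoff n R) p ≤ A / R ^ 2 := by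
      rw [dirD_heatCutoff]
      simp only [inner_zero_right, mul_zero, zero_div, neg_zero, zero_mul, zero_add, mul_one]
      have hd := smoothTransition.monotone.deriv_nonneg (x := -p.2)
      have hp := smoothTransition.nonneg (p.2 / R ^ 2 + 2)
      have hd' := smoothTransition.monotone.deriv_nonneg (x := p.2 / R ^ 2 + 2)
      calc _ ≤ smoothTransition (2 - ‖p.1‖ ^ 2 / R ^ 2) *
            (deriv smoothTransition (p.2 / R ^ 2 + 2) * (1 / R ^ 2) * smoothTransition (-p.2)) := by
            refine mul_le_mul_of_nonneg_left ?_ (smoothTransition.nonneg _)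
            have := mul_nonneg hp hd
            linarith
        _ ≤ 1 * (A * (1 / R ^ 2) * 1) := by
          refine mul_le_mul (smoothTransition.le_one _) ?_
            (mul_nonneg (by positivity) (smoothTransition.nonneg _)) zero_le_one
          refine mul_le_mul ?_ (smoothTransition.le_one _) (smoothTransition.nonneg _)
            (by positivity)
          gcongr
          exact le_of_abs_le (hA _)
        _ = _ := by ring
    calc _ ≤ 1 * (A / R ^ 2) := by
          refine (mul_le_mul_of_nonneg_left h1 (heatCutoff_nonneg R p)).trans ?_
          exact mul_le_mul_of_nonneg_right (heatCutoff_le_one R p) (by positivity)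
      _ ≤ _ := by rw [one_mul]; gcongr; nlinarith

end Cutoff

section Heat

variable {n : ℕ}

lemma fderiv_slice_fst {E : Type*} [NormedAddCommGroup E] [NormedSpace ℝ E] {f : E × ℝ → ℝ}
    (hf : ContDiff ℝ (⊤ : ℕ∞) f) (x v : E) (t : ℝ) :
    fderiv ℝ (fun y => f (y, t)) x v = dirD (v, 0) f (x, t) := by
  have h := (hf.differentiableAt_of_top (x, t)).hasFDerivAt.comp x
    (hasFDerivAt_prodMk_left (𝕜 := ℝ) x t)
  have h' : HasFDerivAt (fun y => f (y, t)) _ x := h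
  rw [h'.fderiv]
  simp [dirD]

lemma deriv_slice_snd {E : Type*} [NormedAddCommGroup E] [NormedSpace ℝ E] {f : E × ℝ → ℝ}
    (hf : ContDiff ℝ (⊤ : ℕ∞) f) (x : E) :
    deriv (fun s => f (x, s)) = fun t => dirD (0, 1) f (x, t) := by
  funext t
  have h := (hf.differentiableAt_of_top (x, t)).hasFDerivAt.comp t
    (hasFDerivAt_prodMk_right (𝕜 := ℝ) x t)
  have h' : HasFDerivAt (fun s => f (x, s)) _ t := h
  rw [h'.hasDerivAt.deriv]
  simp [dirD]

lemma iterate_deriv_slice_snd {E : Type*} [NormedAddCommGroup E] [NormedSpace ℝ E]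
    {f : E × ℝ → ℝ} (hf : ContDiff ℝ (⊤ : ℕ∞) f) (x : E) (k : ℕ) :
    deriv^[k] (fun s => f (x, s)) = fun t => (dirD (0, 1))^[k] f (x, t) := by
  induction k with
  | zero => rfl
  | succ k ih =>
    rw [Function.iterate_succ_apply', ih, deriv_slice_snd (hf.dirD_iterate _ k),
      Function.iterate_succ_apply']

lemma lap_slice {f : EuclideanSpace ℝ (Fin n) × ℝ → ℝ} (hf : ContDiff ℝ (⊤ : ℕ∞) f)
    (x : EuclideanSpace ℝ (Fin n)) (t : ℝ) :
    lap n (fun y => f (y, t)) x =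
      ∑ i, dirD (EuclideanSpace.single i (1 : ℝ), (0 : ℝ))
        (dirD (EuclideanSpace.single i (1 : ℝ), (0 : ℝ)) f) (x, t) := by
  unfold lap
  refine Finset.sum_congr rfl fun i _ => ?_
  simp_rw [fderiv_slice_fst hf]
  exact fderiv_slice_fst (hf.dirD _) _ _ _

lemma lap_sum_mul_const {ι : Type*} (s : Finset ι) {f : ι → EuclideanSpace ℝ (Fin n) → ℝ}
    (hf : ∀ j, ContDiff ℝ (⊤ : ℕ∞) (f j)) (c : ι → ℝ) (x : EuclideanSpace ℝ (Fin n)) :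
    lap n (fun y => ∑ j ∈ s, f j y * c j) x = ∑ j ∈ s, lap n (f j) x * c j := by
  have key : ∀ (v : EuclideanSpace ℝ (Fin n)) {g : ι → EuclideanSpace ℝ (Fin n) → ℝ},
      (∀ j, ContDiff ℝ (⊤ : ℕ∞) (g j)) →
      dirD v (fun y => ∑ j ∈ s, g j y * c j) = fun y => ∑ j ∈ s, dirD v (g j) y * c j := by
    intro v g hg
    funext y
    rw [dirD_sum s fun j => (hg j).mul contDiff_const]
    refine Finset.sum_congr rfl fun j _ => ?_
    rw [dirD_mul (hg j) contDiff_const]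
    simp [dirD, mul_comm]
  change ∑ i, dirD (EuclideanSpace.single i 1) (dirD (EuclideanSpace.single i 1) _) x = _
  simp_rw [key _ hf, key _ fun j => (hf j).dirD _]
  rw [Finset.sum_comm]
  exact Finset.sum_congr rfl fun j _ => (Finset.sum_mul _ _ _).symm

lemma exists_integral_cutoff_bound (n : ℕ) {q c₀ : ℝ} (hc₀ : 0 < c₀)
    {u : EuclideanSpace ℝ (Fin n) × ℝ → ℝ} (Q : ℕ) (hQ : q ≤ Q)
    (hgr : ∀ (x : EuclideanSpace ℝ (Fin n)) (t : ℝ), t ≤ 0 →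
      |u (x, t)| ≤ c₀ * (‖x‖ + √|t| + 1) ^ q) :
    ∃ M : ℝ, 0 ≤ M ∧ ∀ R : ℝ, 1 ≤ R →
      ∫ p, heatCutoff n R p ^ 2 * u p ^ 2 ∂(volume.prod volume) ≤ M * R ^ (2 * (Q + n + 1)) := by
  set μ : Measure (EuclideanSpace ℝ (Fin n) × ℝ) := volume.prod volume
  set V := μ.real (Metric.ball 0 1)
  refine ⟨(c₀ * 5 ^ Q) ^ 2 * (2 ^ (n + 1) * V), by positivity, fun R hR => ?_⟩
  have hb : ∀ p, ‖heatCutoff n R p ^ 2 * u p ^ 2‖ ≤ (c₀ * (5 * R) ^ Q) ^ 2 := by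
    intro p
    by_cases hp : heatCutoff n R p = 0
    · simp [hp]
      positivity
    obtain ⟨h1, h2, h3⟩ := heatCutoff_support (by linarith) hp
    have hsq : √|p.2| ≤ 2 * R := by
      rw [Real.sqrt_le_left (by linarith), abs_le]
      constructor <;> nlinarith
    have hbase : 1 ≤ ‖p.1‖ + √|p.2| + 1 := by
      have := Real.sqrt_nonneg |p.2|
      have := norm_nonneg p.1
      linarith
    have hu : |u p| ≤ c₀ * (5 * R) ^ Q := by
      refine (hgr p.1 p.2 h3.le).trans ?_
      gcongr
      calc (‖p.1‖ + √|p.2| + 1) ^ q ≤ (‖p.1‖ + √|p.2| + 1) ^ (Q : ℝ) :=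
            Real.rpow_le_rpow_of_exponent_le hbase hQ
        _ = (‖p.1‖ + √|p.2| + 1) ^ Q := Real.rpow_natCast _ _
        _ ≤ (5 * R) ^ Q := by
          gcongr
          linarith
    rw [norm_mul, norm_pow, norm_pow, Real.norm_eq_abs, Real.norm_eq_abs,
      abs_of_nonneg (heatCutoff_nonneg R p), ← one_mul ((c₀ * (5 * R) ^ Q) ^ 2)]
    gcongr
    exact pow_le_one₀ (heatCutoff_nonneg R p) (heatCutoff_le_one R p)
  have hset := setIntegral_eq_integral_of_forall_compl_eq_zero (μ := μ)
    (s := Metric.closedBall 0 (2 * R ^ 2)) (f := fun p => heatCutoff n R p ^ 2 * u p ^ 2)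
    (fun p hp => by
      have : heatCutoff n R p = 0 := not_not.1 fun h => hp (heatCutoff_mem_closedBall hR h)
      simp [this])
  have hle := norm_setIntegral_le_of_norm_le_const (μ := μ)
    (measure_closedBall_lt_top (x := 0) (r := 2 * R ^ 2)) fun p _ => hb p
  have hvol : μ.real (Metric.closedBall 0 (2 * R ^ 2)) = (2 * R ^ 2) ^ (n + 1) * V := by
    rw [Measure.real, Measure.addHaar_closedBall μ 0 (by positivity), ENNReal.toReal_mul,
      ENNReal.toReal_ofReal (by positivity)]
    simp [V, Measure.real]
  rw [← hset]
  refine (Real.le_norm_self _).trans (hle.trans (le_of_eq ?_))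
  rw [hvol]
  ring

lemma iterate_time_deriv_eq_zero {q c₀ : ℝ} (hc₀ : 0 < c₀)
    {u : EuclideanSpace ℝ (Fin n) × ℝ → ℝ} (hu : IsAncientHeat n u)
    (hgr : ∀ (x : EuclideanSpace ℝ (Fin n)) (t : ℝ), t ≤ 0 →
      |u (x, t)| ≤ c₀ * (‖x‖ + √|t| + 1) ^ q) :
    ∃ k : ℕ, 1 ≤ k ∧ ∀ (x : EuclideanSpace ℝ (Fin n)) (t : ℝ), t < 0 →
      deriv^[k] (fun s => u (x, s)) t = 0 := by
  obtain ⟨hus, heat⟩ := hu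
  obtain ⟨Q, hQ⟩ := exists_nat_ge q
  obtain ⟨M, hM0, hM⟩ := exists_integral_cutoff_bound n hc₀ Q hQ hgr
  obtain ⟨K, hK0, hK⟩ := exists_heatCutoff_deriv_bound n
  set k := Q + n + 1 with hk
  set μ : Measure (EuclideanSpace ℝ (Fin n) × ℝ) := volume.prod volume
  obtain ⟨C, hC0, hC⟩ := caccioppoli_iterate μ
    (e := fun i => (EuclideanSpace.single i (1 : ℝ), (0 : ℝ)))
    (τ := ((0 : EuclideanSpace ℝ (Fin n)), (1 : ℝ)))
    (isOpen_Iio.preimage continuous_snd : IsOpen {p : EuclideanSpace ℝ (Fin n) × ℝ | p.2 < 0})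
    hus (fun p hp => by
      rw [← lap_slice hus p.1 p.2, heat p.1 p.2 (le_of_lt hp), deriv_slice_snd hus]) k
  refine ⟨k, by lia, fun x t ht => ?_⟩
  rw [iterate_deriv_slice_snd hus]
  set g := (dirD ((0 : EuclideanSpace ℝ (Fin n)), (1 : ℝ)))^[k] u
  have hg : ContDiff ℝ (⊤ : ℕ∞) g := hus.dirD_iterate _ k
  have hint : ∀ R : ℝ, 1 ≤ R → Integrable (fun p => heatCutoff n R p ^ (4 * k + 2) * g p ^ 2) μ :=
    fun R hR => integrable_pow_mul μ (contDiff_heatCutoff R) (hasCompactSupport_heatCutoff hR)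
      (hg.continuous.pow 2) (4 * k + 1)
  have hbound : ∀ R : ℝ, 1 ≤ R →
      (∫ p, heatCutoff n R p ^ (4 * k + 2) * g p ^ 2 ∂μ) * R ≤ C * K ^ (2 * k) * M := by
    intro R hR
    have h := (hC (K / R ^ 2) (heatCutoff n R) (contDiff_heatCutoff R)
      (hasCompactSupport_heatCutoff hR) (heatCutoff_nonneg R) (hK R hR).1 (hK R hR).2
      fun p hp => (heatCutoff_support (by linarith) hp).2.2).trans
      (mul_le_mul_of_nonneg_left (hM R hR) (by positivity))
    have hRk : R ≤ R ^ (2 * k) := le_self_pow₀ hR (by lia)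
    have hI : 0 ≤ ∫ p, heatCutoff n R p ^ (4 * k + 2) * g p ^ 2 ∂μ :=
      integral_nonneg fun p => mul_nonneg (pow_nonneg (heatCutoff_nonneg R p) _) (sq_nonneg _)
    calc _ ≤ (∫ p, heatCutoff n R p ^ (4 * k + 2) * g p ^ 2 ∂μ) * R ^ (2 * k) := by gcongr
      _ ≤ C * (K / R ^ 2) ^ (2 * k) * (M * R ^ (2 * k)) * R ^ (2 * k) := by gcongr
      _ = _ := by
        rw [div_pow, ← pow_mul, show 2 * (2 * k) = 2 * k + 2 * k by ring, pow_add]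
        field_simp
  by_contra hne
  obtain ⟨R₀, hR₀, hp⟩ := exists_heatCutoff_pos (n := n) (p := (x, t)) ht
  have hpos : 0 < ∫ p, heatCutoff n R₀ p ^ (4 * k + 2) * g p ^ 2 ∂μ :=
    Continuous.integral_pos_of_hasCompactSupport_nonneg_nonzero (x := (x, t))
      (f := fun p => heatCutoff n R₀ p ^ (4 * k + 2) * g p ^ 2)
      (((contDiff_heatCutoff R₀).continuous.pow _).mul (hg.continuous.pow 2))
      ((hasCompactSupport_heatCutoff hR₀).pow_mul (4 * k + 1))
      (fun p => mul_nonneg (pow_nonneg (heatCutoff_nonneg R₀ p) _) (sq_nonneg _))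
      (mul_ne_zero (pow_ne_zero _ hp) (pow_ne_zero _ hne))
  obtain ⟨I, hI⟩ : ∃ I, I = ∫ p, heatCutoff n R₀ p ^ (4 * k + 2) * g p ^ 2 ∂μ := ⟨_, rfl⟩
  rw [← hI] at hpos
  obtain ⟨R, hRdef⟩ : ∃ R, R = R₀ + C * K ^ (2 * k) * M / I := ⟨_, rfl⟩
  have hRR : R₀ ≤ R := by
    rw [hRdef]
    exact le_add_of_nonneg_right
      (div_nonneg (mul_nonneg (mul_nonneg hC0 (pow_nonneg hK0 _)) hM0) hpos.le)
  have hmono : I ≤ ∫ p, heatCutoff n R p ^ (4 * k + 2) * g p ^ 2 ∂μ := by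
    rw [hI]
    exact integral_mono (hint R₀ hR₀) (hint R (hR₀.trans hRR)) fun p =>
      mul_le_mul_of_nonneg_right (pow_le_pow_left₀ (heatCutoff_nonneg R₀ p)
        (heatCutoff_mono (by linarith) hRR p) _) (sq_nonneg _)
  have h1 : I * R ≤ C * K ^ (2 * k) * M :=
    (mul_le_mul_of_nonneg_right hmono (by linarith)).trans (hbound R (hR₀.trans hRR))
  have h2 : I * R = I * R₀ + C * K ^ (2 * k) * M := by
    rw [hRdef]
    field_simp
  nlinarith

end Heat

section TimePolynomial

lemma eq_sum_pow_of_iterate_deriv_eq_zero (k : ℕ) :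
    ∀ {f : ℝ → ℝ}, ContDiff ℝ (⊤ : ℕ∞) f → (∀ t < 0, deriv^[k] f t = 0) →
      ∃ c : ℕ → ℝ, ∀ t ≤ 0, f t = ∑ i ∈ Finset.range k, c i * t ^ i := by
  induction k with
  | zero =>
    intro f hf h
    refine ⟨0, fun t ht => ?_⟩
    have hcl : Set.EqOn f (fun _ => 0) (closure (Set.Iio 0)) :=
      Set.EqOn.closure (fun t ht => h t ht) hf.continuous continuous_const
    rw [closure_Iio] at hcl
    simpa using hcl ht
  | succ k ih =>
    intro f hf h
    have hf' : ContDiff ℝ (⊤ : ℕ∞) (deriv f) := hf.iterate_deriv 1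
    obtain ⟨c, hc⟩ := ih hf' fun t ht => by simpa using h t ht
    set P : ℝ → ℝ := fun t => ∑ i ∈ Finset.range k, c i / (i + 1) * t ^ (i + 1)
    have hP : ∀ t, HasDerivAt P (∑ i ∈ Finset.range k, c i * t ^ i) t := fun t => by
      refine HasDerivAt.fun_sum fun i _ => ?_
      refine ((hasDerivAt_pow (i + 1) t).const_mul (c i / (i + 1))).congr_deriv ?_
      push_cast
      field_simp
    have hd : Differentiable ℝ fun t => f t - P t := fun t =>
      (hf.differentiableAt_of_top t).sub (hP t).differentiableAt
    have hconst : Set.EqOn (fun t => f t - P t) (fun _ => f (-1) - P (-1)) (Set.Iio 0) :=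
      fun t ht => isOpen_Iio.is_const_of_deriv_eq_zero (f := fun t => f t - P t)
        isPreconnected_Iio hd.differentiableOn
        (fun s hs => by
          have := ((hf.differentiableAt_of_top s).hasDerivAt.sub (hP s)).deriv
          simp only [Pi.zero_apply]
          rw [← sub_eq_zero.2 (hc s (le_of_lt hs))]
          exact this) ht (by simp : (-1 : ℝ) ∈ Set.Iio 0)
    have hcl := hconst.closure hd.continuous continuous_const
    rw [closure_Iio] at hcl
    refine ⟨fun i => if i = 0 then f (-1) - P (-1) else c (i - 1) / i, fun t ht => ?_⟩
    have ht' : f t - P t = f (-1) - P (-1) := hcl ht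
    rw [Finset.sum_range_succ']
    simp only [Nat.add_eq_zero_iff, one_ne_zero, and_false, if_false, if_true,
      Nat.add_sub_cancel, pow_zero, mul_one]
    push_cast
    linarith

/-- The Lagrange basis polynomials for the nodes `-1, …, -k`. -/
def negBasis (k j : ℕ) : Polynomial ℝ :=
  Lagrange.basis (Finset.range k) (fun i : ℕ => -((i : ℝ) + 1)) j

lemma sum_pow_eq_interpolate (k : ℕ) (c : ℕ → ℝ) (s : ℝ) :
    ∑ i ∈ Finset.range k, c i * s ^ i =
      ∑ j ∈ Finset.range k,
        (∑ i ∈ Finset.range k, c i * (-((j : ℝ) + 1)) ^ i) * (negBasis k j).eval s := by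
  set P : Polynomial ℝ := ∑ i ∈ Finset.range k, Polynomial.C (c i) * Polynomial.X ^ i with hP
  have heval : ∀ r, P.eval r = ∑ i ∈ Finset.range k, c i * r ^ i := fun r => by
    simp [hP, Polynomial.eval_finsetSum]
  have hdeg : P.degree < (Finset.range k).card := by
    rw [Finset.card_range, ← Polynomial.mem_degreeLT]
    refine Submodule.sum_mem _ fun i hi => Polynomial.mem_degreeLT.2 ?_
    exact (Polynomial.degree_C_mul_X_pow_le i (c i)).trans_lt
      (by exact_mod_cast Finset.mem_range.1 hi)
  have hinj : Set.InjOn (fun i : ℕ => -((i : ℝ) + 1)) (Finset.range k) := fun i _ j _ h => by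
    have : (i : ℝ) = j := by simpa using h
    exact_mod_cast this
  have h := congrArg (Polynomial.eval s) (Lagrange.eq_interpolate hinj hdeg)
  rw [Lagrange.interpolate_apply, heval, Polynomial.eval_finsetSum] at h
  simp only [Polynomial.eval_mul, Polynomial.eval_C, heval] at h
  exact h

end TimePolynomial

/-- an ancient solution of the heat equation on `ℝⁿ × (-∞,0]` with
polynomial growth of degree at most `q ≥ 1` extends to an eternal solution on
`ℝⁿ × ℝ` with the same polynomial growth rate. -/
theorem ancient_poly_growth_extends_eternal (n : ℕ) (q c₀ : ℝ)
    (hq : 1 ≤ q) (hc₀ : 0 < c₀)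
    (u : EuclideanSpace ℝ (Fin n) × ℝ → ℝ)
    (hu : IsAncientHeat n u)
    (hgr : ∀ (x : EuclideanSpace ℝ (Fin n)) (t : ℝ), t ≤ 0 →
      |u (x, t)| ≤ c₀ * (‖x‖ + Real.sqrt |t| + 1) ^ q) :
    ∃ v : EuclideanSpace ℝ (Fin n) × ℝ → ℝ,
      ContDiff ℝ (⊤ : ℕ∞) v ∧
      (∀ (x : EuclideanSpace ℝ (Fin n)) (t : ℝ),
        lap n (fun y => v (y, t)) x = deriv (fun s => v (x, s)) t) ∧
      (∀ (x : EuclideanSpace ℝ (Fin n)) (t : ℝ), t ≤ 0 → v (x, t) = u (x, t)) ∧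
      ∃ C : ℝ, 0 < C ∧ ∀ (x : EuclideanSpace ℝ (Fin n)) (t : ℝ),
        |v (x, t)| ≤ C * (‖x‖ + Real.sqrt |t| + 1) ^ q := by
  obtain ⟨k, hk1, hk⟩ := iterate_time_deriv_eq_zero hc₀ hu hgr
  obtain ⟨hus, heat⟩ := hu
  have hslice : ∀ x, ContDiff ℝ (⊤ : ℕ∞) fun s => u (x, s) := fun x =>
    hus.comp (contDiff_const.prodMk contDiff_id)
  have hslice' : ∀ s, ContDiff ℝ (⊤ : ℕ∞) fun y => u (y, s) := fun s =>
    hus.comp (contDiff_id.prodMk contDiff_const)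
  choose c hc using fun x => eq_sum_pow_of_iterate_deriv_eq_zero k (hslice x) (hk x)
  have hneg : ∀ j : ℕ, -((j : ℝ) + 1) ≤ 0 := fun j => by
    have : (0 : ℝ) ≤ j := j.cast_nonneg
    linarith
  set v : EuclideanSpace ℝ (Fin n) × ℝ → ℝ := fun p =>
    ∑ j ∈ Finset.range k, u (p.1, -((j : ℝ) + 1)) * (negBasis k j).eval p.2 with hv
  have hvc : ∀ x t, v (x, t) = ∑ i ∈ Finset.range k, c x i * t ^ i := fun x t => by
    rw [sum_pow_eq_interpolate]
    exact Finset.sum_congr rfl fun j _ => by rw [hc x _ (hneg j)]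
  have hvu : ∀ x t, t ≤ 0 → v (x, t) = u (x, t) := fun x t ht => by rw [hvc, hc x t ht]
  refine ⟨v, ?_, fun x t => ?_, hvu, ?_⟩
  · refine ContDiff.sum fun j _ => ?_
    exact (hus.comp (contDiff_fst.prodMk contDiff_const)).mul
      (((negBasis k j).contDiff_aeval _).comp contDiff_snd)
  · set A : Polynomial ℝ := ∑ j ∈ Finset.range k,
      Polynomial.C (lap n (fun y => u (y, -((j : ℝ) + 1))) x) * negBasis k j with hA
    set B : Polynomial ℝ := ∑ j ∈ Finset.range k,
      Polynomial.C (u (x, -((j : ℝ) + 1))) * negBasis k j with hB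
    have hlap : ∀ s, lap n (fun y => v (y, s)) x = A.eval s := fun s => by
      have h := lap_sum_mul_const (Finset.range k) (f := fun (j : ℕ) y => u (y, -((j : ℝ) + 1)))
        (fun j => hslice' _) (fun j => (negBasis k j).eval s) x
      simp only [hA, Polynomial.eval_finsetSum, Polynomial.eval_mul, Polynomial.eval_C]
      exact h
    have hvB : (fun s => v (x, s)) = fun s => B.eval s := by
      funext s
      simp only [hv, hB, Polynomial.eval_finsetSum, Polynomial.eval_mul, Polynomial.eval_C]
    have hAB : A = B.derivative := by
      refine Polynomial.eq_of_infinite_eval_eq _ _ ((Set.Iio_infinite (0 : ℝ)).mono ?_)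
      intro s hs
      have hs' : s < 0 := hs
      have h1 : (fun y => v (y, s)) = fun y => u (y, s) := funext fun y => hvu y s hs'.le
      have h2 : (fun r => v (x, r)) =ᶠ[nhds s] fun r => u (x, r) :=
        Filter.eventually_of_mem (Iio_mem_nhds hs') fun r hr => hvu x r (le_of_lt hr)
      rw [Set.mem_ofPred_eq, ← hlap, h1, heat x s hs'.le, ← h2.deriv_eq, hvB, Polynomial.deriv]
    rw [hlap, hvB, Polynomial.deriv, hAB]
  · have hL : 0 ≤ ∑ j ∈ Finset.range k, |(negBasis k j).eval 1| :=
      Finset.sum_nonneg fun j _ => abs_nonneg _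
    refine ⟨c₀ + (∑ j ∈ Finset.range k, |(negBasis k j).eval 1|) * (c₀ * (k : ℝ) ^ q),
      by positivity, fun x t => ?_⟩
    have hbase : 0 ≤ ‖x‖ + √|t| + 1 := by positivity
    have hpow : 0 ≤ (‖x‖ + √|t| + 1) ^ q := Real.rpow_nonneg hbase q
    rcases le_or_gt t 0 with ht | ht
    · rw [hvu x t ht]
      refine (hgr x t ht).trans ?_
      gcongr
      exact le_add_of_nonneg_right (by positivity)
    have hrep : v (x, t) = ∑ j ∈ Finset.range k,
        u (x, -((j : ℝ) + 1) * t) * (negBasis k j).eval 1 := by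
      have h := sum_pow_eq_interpolate k (fun i => c x i * t ^ i) 1
      simp only [one_pow, mul_one] at h
      rw [hvc, h]
      refine Finset.sum_congr rfl fun j _ => ?_
      rw [hc x _ (mul_nonpos_of_nonpos_of_nonneg (hneg j) ht.le)]
      simp only [mul_pow, mul_assoc, mul_comm]
    have hk1' : (1 : ℝ) ≤ k := by exact_mod_cast hk1
    have hterm : ∀ j ∈ Finset.range k,
        |u (x, -((j : ℝ) + 1) * t) * (negBasis k j).eval 1| ≤
          |(negBasis k j).eval 1| * (c₀ * (k : ℝ) ^ q * (‖x‖ + √|t| + 1) ^ q) := by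
      intro j hj
      have hjk : (j : ℝ) + 1 ≤ k := by exact_mod_cast Finset.mem_range.1 hj
      have hj0 : (0 : ℝ) ≤ (j : ℝ) + 1 := by positivity
      have hsqrt : √|-((j : ℝ) + 1) * t| ≤ k * √|t| := by
        rw [abs_mul, abs_neg, abs_of_nonneg hj0, Real.sqrt_mul hj0]
        gcongr
        rw [Real.sqrt_le_left (by linarith)]
        nlinarith
      rw [abs_mul, mul_comm]
      gcongr
      refine (hgr x _ (mul_nonpos_of_nonpos_of_nonneg (hneg j) ht.le)).trans ?_
      rw [mul_assoc, ← Real.mul_rpow (by linarith) hbase]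
      gcongr
      nlinarith [norm_nonneg x]
    rw [hrep]
    refine (Finset.abs_sum_le_sum_abs _ _).trans ((Finset.sum_le_sum hterm).trans ?_)
    rw [← Finset.sum_mul]
    nlinarith [mul_nonneg hc₀.le hpow]
end
end

section
/- There is a constant C₀, depending only on n, with the following property. Let u be a smooth solution of the heat equation Δ_x u = ∂_t u on all of ℝⁿ × ℝ. Then for every integer k ≥ 1, every (x₁,t₁) ∈ ℝⁿ × ℝ and every R > 0, one has ∫_{Q⁰_R(x₁,t₁)} (∂_t^k u)² dx dt ≤ (C₀^k / R^{4k}) ∫_{Q⁰_{2^k R}(x₁,t₁)} u² dx dt. -/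
open MeasureTheory Real

noncomputable section

/-- The full parabolic cube `Q⁰_R(x₁,t₁) = {(x,t) : |x − x₁| < R, |t − t₁| ≤ R²}`. -/
def Qcube (n : ℕ) (R : ℝ) (x₁ : EuclideanSpace ℝ (Fin n)) (t₁ : ℝ) :
    Set (EuclideanSpace ℝ (Fin n) × ℝ) :=
  {p | dist p.1 x₁ < R ∧ |p.2 - t₁| ≤ R ^ 2}

section DirectionalDerivative

variable {X : Type*} [NormedAddCommGroup X] [NormedSpace ℝ X]

/-- The derivative of `f` in the direction `v`. -/
def dirDeriv (v : X) (f : X → ℝ) (p : X) : ℝ := fderiv ℝ f p v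

lemma ContDiff.dirDeriv {f : X → ℝ} (hf : ContDiff ℝ (⊤ : ℕ∞) f) (v : X) :
    ContDiff ℝ (⊤ : ℕ∞) (dirDeriv v f) :=
  (hf.fderiv_right (m := (⊤ : ℕ∞)) (by simp)).clm_apply contDiff_const

lemma dirDeriv_mul {f g : X → ℝ} (hf : ContDiff ℝ (⊤ : ℕ∞) f) (hg : ContDiff ℝ (⊤ : ℕ∞) g)
    (v p : X) :
    dirDeriv v (fun q => f q * g q) p = f p * dirDeriv v g p + dirDeriv v f p * g p := by
  have hf' : DifferentiableAt ℝ f p := hf.differentiable (by simp) p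
  have hg' : DifferentiableAt ℝ g p := hg.differentiable (by simp) p
  simp only [dirDeriv]
  rw [fderiv_fun_mul hf' hg']
  simp [mul_comm]

lemma dirDeriv_comm {f : X → ℝ} (hf : ContDiff ℝ (⊤ : ℕ∞) f) (v w p : X) :
    dirDeriv v (dirDeriv w f) p = dirDeriv w (dirDeriv v f) p := by
  have hd : DifferentiableAt ℝ (fderiv ℝ f) p :=
    (hf.fderiv_right (m := (⊤ : ℕ∞)) (by simp)).differentiable (by simp) p
  have key : ∀ a b : X, dirDeriv a (dirDeriv b f) p = fderiv ℝ (fderiv ℝ f) p a b := by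
    intro a b
    unfold dirDeriv
    rw [fderiv_clm_apply hd (differentiableAt_const b)]
    simp
  rw [key, key]
  exact (hf.contDiffAt.isSymmSndFDerivAt (by
    rw [minSmoothness_of_isRCLikeNormedField]
    exact WithTop.coe_le_coe.2 (le_top : (2 : ℕ∞) ≤ ⊤))).eq v w

lemma dirDeriv_sum {ι : Type*} [Fintype ι] {f : ι → X → ℝ}
    (hf : ∀ i, ContDiff ℝ (⊤ : ℕ∞) (f i)) (v p : X) :
    dirDeriv v (fun q => ∑ i, f i q) p = ∑ i, dirDeriv v (f i) p := by
  simp only [dirDeriv]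
  rw [fderiv_fun_sum fun i _ => (hf i).differentiable (by simp) p]
  simp

lemma HasCompactSupport.dirDeriv {f : X → ℝ} (hf : HasCompactSupport f) (v : X) :
    HasCompactSupport (dirDeriv v f) :=
  hf.fderiv_apply (𝕜 := ℝ) v

/-- A cutoff function whose squared gradient along the directions `e` and whose derivative along
`τ` are bounded by `A`. -/
structure IsParabolicCutoff {ι : Type*} [Fintype ι] (e : ι → X) (τ : X) (A : ℝ) (Q : Set X)
    (φ : X → ℝ) : Prop where
  contDiff : ContDiff ℝ (⊤ : ℕ∞) φ
  hasCompactSupport : HasCompactSupport φ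
  nonneg : ∀ p, 0 ≤ φ p
  le_one : ∀ p, φ p ≤ 1
  eq_zero : ∀ p, p ∉ Q → φ p = 0
  abs_dirDeriv_le : ∀ p, |dirDeriv τ φ p| ≤ A
  sum_sq_dirDeriv_le : ∀ p, ∑ i, dirDeriv (e i) φ p ^ 2 ≤ A

variable {ι : Type*} [Fintype ι] {e : ι → X} {τ : X} {A : ℝ} {Q : Set X} {φ u : X → ℝ}

lemma IsParabolicCutoff.dirDeriv_eq_zero (h : IsParabolicCutoff e τ A Q φ) {p : X} (hp : p ∉ Q)
    (v : X) : dirDeriv v φ p = 0 := by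
  have hm : IsLocalMin φ p := Filter.Eventually.of_forall fun q => by
    rw [h.eq_zero p hp]; exact h.nonneg q
  simp [dirDeriv, hm.fderiv_eq_zero]

lemma IsParabolicCutoff.mul_dirDeriv_le (h : IsParabolicCutoff e τ A Q φ) (p : X) :
    φ p * dirDeriv τ φ p ≤ A :=
  calc φ p * dirDeriv τ φ p ≤ φ p * |dirDeriv τ φ p| :=
        mul_le_mul_of_nonneg_left (le_abs_self _) (h.nonneg p)
    _ ≤ |dirDeriv τ φ p| := mul_le_of_le_one_left (abs_nonneg _) (h.le_one p)
    _ ≤ A := h.abs_dirDeriv_le p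

variable [MeasurableSpace X] [BorelSpace X]
  (μ : Measure X) [μ.IsAddHaarMeasure]

lemma integrable_dirDeriv {F : X → ℝ} (hF : ContDiff ℝ (⊤ : ℕ∞) F) (hc : HasCompactSupport F)
    (v : X) : Integrable (dirDeriv v F) μ :=
  (hF.dirDeriv v).continuous.integrable_of_hasCompactSupport (hc.dirDeriv v)

lemma IsParabolicCutoff.integrable_energy (h : IsParabolicCutoff e τ A Q φ)
    (hu : ContDiff ℝ (⊤ : ℕ∞) u) :
    Integrable (fun p => φ p ^ 2 * ∑ i, dirDeriv (e i) u p ^ 2) μ := by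
  refine Continuous.integrable_of_hasCompactSupport ?_ ?_
  · exact (h.contDiff.continuous.pow 2).mul
      (continuous_finsetSum _ fun i _ => (hu.dirDeriv (e i)).continuous.pow 2)
  · simp_rw [sq (φ _), mul_assoc]
    exact h.hasCompactSupport.mul_right

lemma IsParabolicCutoff.integrable_sq_timeDeriv (h : IsParabolicCutoff e τ A Q φ)
    (hu : ContDiff ℝ (⊤ : ℕ∞) u) :
    Integrable (fun p => φ p ^ 4 * dirDeriv τ u p ^ 2) μ := by
  refine Continuous.integrable_of_hasCompactSupport ?_ ?_
  · exact (h.contDiff.continuous.pow 4).mul ((hu.dirDeriv τ).continuous.pow 2)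
  · simp_rw [pow_succ' (φ _) 3, mul_assoc]
    exact h.hasCompactSupport.mul_right

variable [FiniteDimensional ℝ X]

lemma integral_dirDeriv_mul_eq_zero {g : X → ℝ} (hφ : ContDiff ℝ (⊤ : ℕ∞) φ)
    (hc : HasCompactSupport φ) (hg : ContDiff ℝ (⊤ : ℕ∞) g) (v : X) :
    ∫ p, dirDeriv v (fun q => φ q * g q) p ∂μ = 0 := by
  have h₁ : Integrable (fun p => φ p * dirDeriv v g p) μ :=
    (hφ.continuous.mul (hg.dirDeriv v).continuous).integrable_of_hasCompactSupport hc.mul_right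
  have h₂ : Integrable (fun p => dirDeriv v φ p * g p) μ :=
    ((hφ.dirDeriv v).continuous.mul hg.continuous).integrable_of_hasCompactSupport
      (hc.dirDeriv v).mul_right
  have h₃ : Integrable (fun p => φ p * g p) μ :=
    (hφ.continuous.mul hg.continuous).integrable_of_hasCompactSupport hc.mul_right
  have h := integral_mul_fderiv_eq_neg_fderiv_mul_of_integrable (μ := μ) (v := v) h₂ h₁ h₃
    (fun x _ => hφ.differentiable (by simp) x) (fun x _ => hg.differentiable (by simp) x)
  simp_rw [dirDeriv_mul hφ hg]
  rw [integral_add h₁ h₂]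
  simp only [dirDeriv] at h ⊢
  linarith

/-- Caccioppoli inequality: the localized energy of a solution of the heat equation is controlled
by its `L²` norm. -/
lemma caccioppoli_energy (h : IsParabolicCutoff e τ A Q φ) (hu : ContDiff ℝ (⊤ : ℕ∞) u)
    (heat : ∀ p, ∑ i, dirDeriv (e i) (dirDeriv (e i) u) p = dirDeriv τ u p)
    (hQ : MeasurableSet Q) (hQu : IntegrableOn (fun p => u p ^ 2) Q μ) :
    ∫ p, φ p ^ 2 * ∑ i, dirDeriv (e i) u p ^ 2 ∂μ ≤ 6 * A * ∫ p in Q, u p ^ 2 ∂μ := by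
  have hφ := h.contDiff
  have hc := h.hasCompactSupport
  have hd := fun i => hu.dirDeriv (e i)
  let G : ι → X → ℝ := fun i q => φ q * (φ q * (u q * dirDeriv (e i) u q))
  let T : X → ℝ := fun q => φ q * (φ q * (u q * u q))
  have hG : ∀ i, Integrable (dirDeriv (e i) (G i)) μ := fun i =>
    integrable_dirDeriv μ (hφ.mul (hφ.mul (hu.mul (hd i)))) hc.mul_right (e i)
  have hT : Integrable (dirDeriv τ T) μ :=
    integrable_dirDeriv μ (hφ.mul (hφ.mul (hu.mul hu))) hc.mul_right τ
  have hG0 : ∀ i, ∫ p, dirDeriv (e i) (G i) p ∂μ = 0 := fun i =>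
    integral_dirDeriv_mul_eq_zero μ hφ hc (hφ.mul (hu.mul (hd i))) (e i)
  have hT0 : ∫ p, dirDeriv τ T p ∂μ = 0 :=
    integral_dirDeriv_mul_eq_zero μ hφ hc (hφ.mul (hu.mul hu)) τ
  have eG : ∀ i p, dirDeriv (e i) (G i) p =
      φ p ^ 2 * (u p * dirDeriv (e i) (dirDeriv (e i) u) p + dirDeriv (e i) u p ^ 2) +
        2 * φ p * dirDeriv (e i) φ p * u p * dirDeriv (e i) u p := by
    intro i p
    rw [dirDeriv_mul hφ (hφ.mul (hu.mul (hd i))), dirDeriv_mul hφ (hu.mul (hd i)),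
      dirDeriv_mul hu (hd i)]
    ring
  have eT : ∀ p, dirDeriv τ T p =
      2 * φ p * dirDeriv τ φ p * u p ^ 2 + 2 * φ p ^ 2 * u p * dirDeriv τ u p := by
    intro p
    rw [dirDeriv_mul hφ (hφ.mul (hu.mul hu)), dirDeriv_mul hφ (hu.mul hu), dirDeriv_mul hu hu]
    ring
  have hI : Integrable (Q.indicator fun p => u p ^ 2) μ := hQu.integrable_indicator hQ
  have hsum : Integrable (fun p => ∑ i, dirDeriv (e i) (G i) p) μ :=
    integrable_finsetSum _ fun i _ => hG i
  have hdiff : Integrable (fun p => 2 * ∑ i, dirDeriv (e i) (G i) p - dirDeriv τ T p) μ :=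
    (hsum.const_mul 2).sub hT
  have pointwise : ∀ p, φ p ^ 2 * ∑ i, dirDeriv (e i) u p ^ 2 ≤
      2 * ∑ i, dirDeriv (e i) (G i) p - dirDeriv τ T p +
        6 * A * Q.indicator (fun p => u p ^ 2) p := by
    intro p
    have h₁ : ∑ i, (φ p ^ 2 * u p * dirDeriv (e i) (dirDeriv (e i) u) p +
        1 / 2 * φ p ^ 2 * dirDeriv (e i) u p ^ 2 - 2 * u p ^ 2 * dirDeriv (e i) φ p ^ 2) ≤
        ∑ i, dirDeriv (e i) (G i) p := by
      refine Finset.sum_le_sum fun i _ => ?_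
      rw [eG]
      nlinarith [sq_nonneg (φ p * dirDeriv (e i) u p + 2 * u p * dirDeriv (e i) φ p)]
    rw [Finset.sum_sub_distrib, Finset.sum_add_distrib, ← Finset.mul_sum, ← Finset.mul_sum,
      ← Finset.mul_sum, heat] at h₁
    have h₂ : φ p * dirDeriv τ φ p * u p ^ 2 + 2 * u p ^ 2 * ∑ i, dirDeriv (e i) φ p ^ 2 ≤
        3 * A * Q.indicator (fun p => u p ^ 2) p := by
      by_cases hp : p ∈ Q
      · rw [Set.indicator_of_mem hp]
        nlinarith [mul_le_mul_of_nonneg_right (h.mul_dirDeriv_le p) (sq_nonneg (u p)),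
          mul_le_mul_of_nonneg_right (h.sum_sq_dirDeriv_le p) (sq_nonneg (u p))]
      · simp [Set.indicator_of_notMem hp, h.dirDeriv_eq_zero hp]
    rw [eT]
    linarith
  calc ∫ p, φ p ^ 2 * ∑ i, dirDeriv (e i) u p ^ 2 ∂μ
      ≤ ∫ p, (2 * ∑ i, dirDeriv (e i) (G i) p - dirDeriv τ T p +
        6 * A * Q.indicator (fun p => u p ^ 2) p) ∂μ :=
        integral_mono (h.integrable_energy μ hu)
          (hdiff.add (hI.const_mul _)) pointwise
    _ = 6 * A * ∫ p in Q, u p ^ 2 ∂μ := by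
        rw [integral_add hdiff (hI.const_mul _),
          integral_sub (hsum.const_mul 2) hT, integral_const_mul, integral_const_mul,
          integral_finsetSum _ fun i _ => hG i, integral_indicator hQ, hT0]
        simp [hG0]

/-- The localized `L²` norm of the time derivative of a solution of the heat equation is controlled
by its localized energy. -/
lemma integral_sq_timeDeriv_le_energy (h : IsParabolicCutoff e τ A Q φ)
    (hu : ContDiff ℝ (⊤ : ℕ∞) u) (hA : 0 < A)
    (heat : ∀ p, ∑ i, dirDeriv (e i) (dirDeriv (e i) u) p = dirDeriv τ u p) :
    ∫ p, φ p ^ 4 * dirDeriv τ u p ^ 2 ∂μ ≤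
      20 * A * ∫ p, φ p ^ 2 * ∑ i, dirDeriv (e i) u p ^ 2 ∂μ := by
  have hφ := h.contDiff
  have hd := fun i => hu.dirDeriv (e i)
  have ht := hu.dirDeriv τ
  let χ : X → ℝ := fun q => φ q * φ q
  have hχ : ContDiff ℝ (⊤ : ℕ∞) χ := hφ.mul hφ
  have hχc : HasCompactSupport χ := h.hasCompactSupport.mul_right
  let G : ι → X → ℝ := fun i q => χ q * (χ q * (dirDeriv τ u q * dirDeriv (e i) u q))
  let T : ι → X → ℝ := fun i q => χ q * (χ q * (dirDeriv (e i) u q * dirDeriv (e i) u q))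
  have hG : ∀ i, Integrable (dirDeriv (e i) (G i)) μ := fun i =>
    integrable_dirDeriv μ (hχ.mul (hχ.mul (ht.mul (hd i)))) hχc.mul_right (e i)
  have hT : ∀ i, Integrable (dirDeriv τ (T i)) μ := fun i =>
    integrable_dirDeriv μ (hχ.mul (hχ.mul ((hd i).mul (hd i)))) hχc.mul_right τ
  have hG0 : ∀ i, ∫ p, dirDeriv (e i) (G i) p ∂μ = 0 := fun i =>
    integral_dirDeriv_mul_eq_zero μ hχ hχc (hχ.mul (ht.mul (hd i))) (e i)
  have hT0 : ∀ i, ∫ p, dirDeriv τ (T i) p ∂μ = 0 := fun i =>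
    integral_dirDeriv_mul_eq_zero μ hχ hχc (hχ.mul ((hd i).mul (hd i))) τ
  have eG : ∀ i p, dirDeriv (e i) (G i) p =
      φ p ^ 4 * (dirDeriv τ u p * dirDeriv (e i) (dirDeriv (e i) u) p +
        dirDeriv τ (dirDeriv (e i) u) p * dirDeriv (e i) u p) +
        4 * φ p ^ 3 * dirDeriv (e i) φ p * dirDeriv τ u p * dirDeriv (e i) u p := by
    intro i p
    rw [dirDeriv_mul hχ (hχ.mul (ht.mul (hd i))), dirDeriv_mul hχ (ht.mul (hd i)),
      dirDeriv_mul ht (hd i), dirDeriv_mul hφ hφ, dirDeriv_comm hu (e i) τ]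
    ring
  have eT : ∀ i p, dirDeriv τ (T i) p =
      4 * φ p ^ 3 * dirDeriv τ φ p * dirDeriv (e i) u p ^ 2 +
        2 * φ p ^ 4 * dirDeriv τ (dirDeriv (e i) u) p * dirDeriv (e i) u p := by
    intro i p
    rw [dirDeriv_mul hχ (hχ.mul ((hd i).mul (hd i))), dirDeriv_mul hχ ((hd i).mul (hd i)),
      dirDeriv_mul (hd i) (hd i), dirDeriv_mul hφ hφ]
    ring
  have hsumG : Integrable (fun p => ∑ i, dirDeriv (e i) (G i) p) μ :=
    integrable_finsetSum _ fun i _ => hG i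
  have hsumT : Integrable (fun p => ∑ i, dirDeriv τ (T i) p) μ :=
    integrable_finsetSum _ fun i _ => hT i
  have hdiff : Integrable (fun p => 2 * ∑ i, dirDeriv (e i) (G i) p -
      ∑ i, dirDeriv τ (T i) p) μ := (hsumG.const_mul 2).sub hsumT
  have pointwise : ∀ p, φ p ^ 4 * dirDeriv τ u p ^ 2 ≤
      2 * ∑ i, dirDeriv (e i) (G i) p - ∑ i, dirDeriv τ (T i) p +
        20 * A * (φ p ^ 2 * ∑ i, dirDeriv (e i) u p ^ 2) := by
    intro p
    have h₁ : ∑ i, (2 * φ p ^ 4 * dirDeriv τ u p * dirDeriv (e i) (dirDeriv (e i) u) p -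
        φ p ^ 4 * dirDeriv τ u p ^ 2 / A * dirDeriv (e i) φ p ^ 2 -
        20 * A * φ p ^ 2 * dirDeriv (e i) u p ^ 2) ≤
        ∑ i, (2 * dirDeriv (e i) (G i) p - dirDeriv τ (T i) p) := by
      refine Finset.sum_le_sum fun i _ => ?_
      rw [eG, eT]
      have h₂ := mul_le_mul_of_nonneg_right (h.mul_dirDeriv_le p)
        (mul_nonneg (sq_nonneg (φ p)) (sq_nonneg (dirDeriv (e i) u p)))
      have h₃ : 0 ≤ (φ p ^ 2 * dirDeriv τ u p * dirDeriv (e i) φ p +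
          4 * A * φ p * dirDeriv (e i) u p) ^ 2 / A := by positivity
      have h₄ : (φ p ^ 2 * dirDeriv τ u p * dirDeriv (e i) φ p +
          4 * A * φ p * dirDeriv (e i) u p) ^ 2 / A =
          φ p ^ 4 * dirDeriv τ u p ^ 2 / A * dirDeriv (e i) φ p ^ 2 +
          8 * φ p ^ 3 * dirDeriv (e i) φ p * dirDeriv τ u p * dirDeriv (e i) u p +
          16 * A * φ p ^ 2 * dirDeriv (e i) u p ^ 2 := by
        field_simp
        ring
      linarith
    simp only [Finset.sum_sub_distrib, ← Finset.mul_sum] at h₁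
    rw [heat] at h₁
    have h₂ : φ p ^ 4 * dirDeriv τ u p ^ 2 / A * ∑ i, dirDeriv (e i) φ p ^ 2 ≤
        φ p ^ 4 * dirDeriv τ u p ^ 2 := by
      calc _ ≤ φ p ^ 4 * dirDeriv τ u p ^ 2 / A * A :=
            mul_le_mul_of_nonneg_left (h.sum_sq_dirDeriv_le p) (by positivity)
        _ = _ := div_mul_cancel₀ _ hA.ne'
    linarith
  have hφS := h.integrable_energy μ hu
  calc ∫ p, φ p ^ 4 * dirDeriv τ u p ^ 2 ∂μ
      ≤ ∫ p, (2 * ∑ i, dirDeriv (e i) (G i) p - ∑ i, dirDeriv τ (T i) p +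
        20 * A * (φ p ^ 2 * ∑ i, dirDeriv (e i) u p ^ 2)) ∂μ :=
        integral_mono (h.integrable_sq_timeDeriv μ hu)
          (hdiff.add (hφS.const_mul _)) pointwise
    _ = _ := by
        rw [integral_add hdiff (hφS.const_mul _),
          integral_sub (hsumG.const_mul 2) hsumT, integral_const_mul, integral_const_mul,
          integral_finsetSum _ fun i _ => hG i, integral_finsetSum _ fun i _ => hT i]
        simp [hG0, hT0]

end DirectionalDerivative

section ParabolicCube

variable {n : ℕ}

/-- The `i`-th spatial unit vector of `ℝⁿ × ℝ`. -/
def spaceDir (n : ℕ) (i : Fin n) : EuclideanSpace ℝ (Fin n) × ℝ := (EuclideanSpace.single i 1, 0)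

/-- The unit vector of `ℝⁿ × ℝ` in the time direction. -/
def timeDir (n : ℕ) : EuclideanSpace ℝ (Fin n) × ℝ := (0, 1)

instance : (volume : Measure (EuclideanSpace ℝ (Fin n) × ℝ)).IsAddHaarMeasure :=
  inferInstanceAs (Measure.prod volume volume).IsAddHaarMeasure

lemma Qcube_eq_prod (R : ℝ) (x₁ : EuclideanSpace ℝ (Fin n)) (t₁ : ℝ) :
    Qcube n R x₁ t₁ = Metric.ball x₁ R ×ˢ Metric.closedBall t₁ (R ^ 2) := by
  ext p
  simp [Qcube, Real.dist_eq]

lemma measurableSet_Qcube (R : ℝ) (x₁ : EuclideanSpace ℝ (Fin n)) (t₁ : ℝ) :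
    MeasurableSet (Qcube n R x₁ t₁) := by
  rw [Qcube_eq_prod]
  exact measurableSet_ball.prod measurableSet_closedBall

lemma Continuous.integrableOn_Qcube {f : EuclideanSpace ℝ (Fin n) × ℝ → ℝ} (hf : Continuous f)
    (R : ℝ) (x₁ : EuclideanSpace ℝ (Fin n)) (t₁ : ℝ) : IntegrableOn f (Qcube n R x₁ t₁) := by
  refine (hf.continuousOn.integrableOn_compact
    ((isCompact_closedBall x₁ R).prod (isCompact_closedBall t₁ (R ^ 2)))).mono_set ?_
  rw [Qcube_eq_prod]
  exact Set.prod_mono Metric.ball_subset_closedBall le_rfl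

/-- The map of `ℝⁿ × ℝ` sending the parabolic cube of size `R` centred at `(x₁, t₁)` to the unit
parabolic cube. -/
def parabolicRescale (R : ℝ) (x₁ : EuclideanSpace ℝ (Fin n)) (t₁ : ℝ)
    (p : EuclideanSpace ℝ (Fin n) × ℝ) : EuclideanSpace ℝ (Fin n) × ℝ :=
  (R⁻¹ • (p.1 - x₁), (R ^ 2)⁻¹ * (p.2 - t₁))

lemma parabolicRescale_mem_Qcube {R : ℝ} (hR : 0 < R) {r : ℝ} {x₁ : EuclideanSpace ℝ (Fin n)}
    {t₁ : ℝ} {p : EuclideanSpace ℝ (Fin n) × ℝ} :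
    parabolicRescale R x₁ t₁ p ∈ Qcube n r 0 0 ↔ p ∈ Qcube n (r * R) x₁ t₁ := by
  simp only [Qcube, parabolicRescale, Set.mem_ofPred_eq, dist_zero_right, norm_smul, norm_inv,
    Real.norm_eq_abs, abs_of_pos hR, sub_zero, abs_mul, abs_inv, abs_pow, ← dist_eq_norm]
  rw [inv_mul_lt_iff₀ hR, inv_mul_le_iff₀ (by positivity), mul_pow, mul_comm r, mul_comm (r ^ 2)]

lemma dirDeriv_comp_parabolicRescale {φ : EuclideanSpace ℝ (Fin n) × ℝ → ℝ}
    (hφ : ContDiff ℝ (⊤ : ℕ∞) φ) (R : ℝ) (x₁ : EuclideanSpace ℝ (Fin n)) (t₁ : ℝ)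
    (v p : EuclideanSpace ℝ (Fin n) × ℝ) :
    dirDeriv v (φ ∘ parabolicRescale R x₁ t₁) p =
      dirDeriv (R⁻¹ • v.1, (R ^ 2)⁻¹ * v.2) φ (parabolicRescale R x₁ t₁ p) := by
  have h₁ : HasFDerivAt (fun p : EuclideanSpace ℝ (Fin n) × ℝ => R⁻¹ • (p.1 - x₁))
      (R⁻¹ • ContinuousLinearMap.fst ℝ _ _) p := (hasFDerivAt_fst.sub_const x₁).const_smul R⁻¹
  have h₂ : HasFDerivAt (fun p : EuclideanSpace ℝ (Fin n) × ℝ => (R ^ 2)⁻¹ * (p.2 - t₁))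
      ((R ^ 2)⁻¹ • ContinuousLinearMap.snd ℝ _ _) p :=
    (hasFDerivAt_snd.sub_const t₁).const_mul (R ^ 2)⁻¹
  have h₃ : HasFDerivAt (φ ∘ parabolicRescale R x₁ t₁) _ p :=
    (hφ.differentiable (by simp) (parabolicRescale R x₁ t₁ p)).hasFDerivAt.comp p (h₁.prodMk h₂)
  unfold dirDeriv
  rw [h₃.fderiv]
  simp

lemma exists_unit_cutoff (n : ℕ) : ∃ (φ : EuclideanSpace ℝ (Fin n) × ℝ → ℝ) (M : ℝ), 0 < M ∧
    IsParabolicCutoff (spaceDir n) (timeDir n) M (Qcube n 2 0 0) φ ∧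
      ∀ p ∈ Qcube n 1 0 0, φ p = 1 := by
  let a : ContDiffBump (0 : EuclideanSpace ℝ (Fin n)) := ⟨1, 2, one_pos, one_lt_two⟩
  let b : ContDiffBump (0 : ℝ) := ⟨1, 2, one_pos, one_lt_two⟩
  let φ : EuclideanSpace ℝ (Fin n) × ℝ → ℝ := fun p => a p.1 * b p.2
  have hφ : ContDiff ℝ (⊤ : ℕ∞) φ :=
    (a.contDiff.comp contDiff_fst).mul (b.contDiff.comp contDiff_snd)
  have hc : HasCompactSupport φ := by
    refine HasCompactSupport.intro (K := Metric.closedBall 0 2 ×ˢ Metric.closedBall 0 2)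
      ((isCompact_closedBall _ _).prod (isCompact_closedBall _ _)) fun p hp => ?_
    rw [Set.mem_prod, not_and_or] at hp
    rcases hp with hp | hp
    · simp only [φ, a.zero_of_le_dist (x := p.1) (not_le.1 hp).le, zero_mul]
    · simp only [φ, b.zero_of_le_dist (x := p.2) (not_le.1 hp).le, mul_zero]
  obtain ⟨M₁, hM₁⟩ := (hc.dirDeriv (timeDir n)).exists_bound_of_continuous
    (hφ.dirDeriv (timeDir n)).continuous
  have hS : Continuous fun p => ∑ i, dirDeriv (spaceDir n i) φ p ^ 2 :=
    continuous_finsetSum _ fun i _ => (hφ.dirDeriv _).continuous.pow 2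
  have hSc : HasCompactSupport fun p => ∑ i, dirDeriv (spaceDir n i) φ p ^ 2 := by
    refine HasCompactSupport.intro hc.isCompact fun p hp => ?_
    refine Finset.sum_eq_zero fun i _ => ?_
    have : fderiv ℝ φ p = 0 := Function.notMem_support.1 fun hm => hp (support_fderiv_subset ℝ hm)
    simp [dirDeriv, this]
  obtain ⟨M₂, hM₂⟩ := hSc.exists_bound_of_continuous hS
  refine ⟨φ, max 1 (max M₁ M₂), by positivity, ⟨hφ, hc, fun p => mul_nonneg a.nonneg b.nonneg,
    fun p => mul_le_one₀ a.le_one b.nonneg b.le_one, fun p hp => ?_, fun p => ?_, fun p => ?_⟩,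
    fun p hp => ?_⟩
  · rw [Qcube_eq_prod, Set.mem_prod, not_and_or] at hp
    rcases hp with hp | hp
    · simp only [φ, a.zero_of_le_dist (x := p.1) (not_lt.1 hp), zero_mul]
    · have hp' : (2 : ℝ) ≤ dist p.2 0 := by
        rw [Metric.mem_closedBall, not_le] at hp
        linarith
      simp only [φ, b.zero_of_le_dist (x := p.2) hp', mul_zero]
  · exact (hM₁ p).trans ((le_max_left _ _).trans (le_max_right _ _))
  · exact (le_abs_self _).trans ((hM₂ p).trans ((le_max_right _ _).trans (le_max_right _ _)))
  · rw [Qcube_eq_prod, Set.mem_prod] at hp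
    have h₁ : a p.1 = 1 := a.one_of_mem_closedBall (Metric.ball_subset_closedBall hp.1)
    have h₂ : b p.2 = 1 := b.one_of_mem_closedBall (by simpa [b] using hp.2)
    simp only [φ, h₁, h₂, mul_one]

lemma IsParabolicCutoff.comp_parabolicRescale {φ : EuclideanSpace ℝ (Fin n) × ℝ → ℝ} {M R r : ℝ}
    (h : IsParabolicCutoff (spaceDir n) (timeDir n) M (Qcube n r 0 0) φ) (hR : 0 < R)
    (x₁ : EuclideanSpace ℝ (Fin n)) (t₁ : ℝ) :
    IsParabolicCutoff (spaceDir n) (timeDir n) (M / R ^ 2) (Qcube n (r * R) x₁ t₁)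
      (φ ∘ parabolicRescale R x₁ t₁) where
  contDiff := h.contDiff.comp <| by
    unfold parabolicRescale
    fun_prop
  hasCompactSupport := by
    have : Continuous fun q : EuclideanSpace ℝ (Fin n) × ℝ => (R • q.1 + x₁, R ^ 2 * q.2 + t₁) := by
      fun_prop
    refine HasCompactSupport.intro (h.hasCompactSupport.isCompact.image this) fun p hp => ?_
    refine image_eq_zero_of_notMem_tsupport (f := φ) fun hm => hp ⟨_, hm, ?_⟩
    ext1
    · simp [parabolicRescale, smul_smul, hR.ne']
    · simp [parabolicRescale, hR.ne']
  nonneg p := h.nonneg _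
  le_one p := h.le_one _
  eq_zero p hp := h.eq_zero _ fun hm => hp ((parabolicRescale_mem_Qcube hR).1 hm)
  abs_dirDeriv_le p := by
    have : (R⁻¹ • (timeDir n).1, (R ^ 2)⁻¹ * (timeDir n).2) = (R ^ 2)⁻¹ • timeDir n := by
      simp [timeDir]
    rw [dirDeriv_comp_parabolicRescale h.contDiff, this, dirDeriv, map_smul, smul_eq_mul, abs_mul,
      abs_of_pos (by positivity), inv_mul_eq_div]
    gcongr
    exact h.abs_dirDeriv_le _
  sum_sq_dirDeriv_le p := by
    have (i : Fin n) : (R⁻¹ • (spaceDir n i).1, (R ^ 2)⁻¹ * (spaceDir n i).2) =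
        R⁻¹ • spaceDir n i := by
      simp [spaceDir]
    simp_rw [dirDeriv_comp_parabolicRescale h.contDiff, this, dirDeriv, map_smul, smul_eq_mul,
      mul_pow, ← Finset.mul_sum, inv_pow, inv_mul_eq_div]
    gcongr
    exact h.sum_sq_dirDeriv_le _

lemma exists_integral_sq_timeDeriv_le (n : ℕ) : ∃ C : ℝ, 0 < C ∧
    ∀ u : EuclideanSpace ℝ (Fin n) × ℝ → ℝ, ContDiff ℝ (⊤ : ℕ∞) u →
      (∀ p, ∑ i, dirDeriv (spaceDir n i) (dirDeriv (spaceDir n i) u) p =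
        dirDeriv (timeDir n) u p) →
      ∀ (x₁ : EuclideanSpace ℝ (Fin n)) (t₁ R : ℝ), 0 < R →
        ∫ p in Qcube n R x₁ t₁, dirDeriv (timeDir n) u p ^ 2 ≤
          C / R ^ 4 * ∫ p in Qcube n (2 * R) x₁ t₁, u p ^ 2 := by
  obtain ⟨φ₀, M, hM, h₀, hone⟩ := exists_unit_cutoff n
  refine ⟨120 * M ^ 2, by positivity, fun u hu heat x₁ t₁ R hR => ?_⟩
  have h := h₀.comp_parabolicRescale hR x₁ t₁
  set φ := φ₀ ∘ parabolicRescale R x₁ t₁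
  have hA : 0 < M / R ^ 2 := by positivity
  have hone' : ∀ p ∈ Qcube n R x₁ t₁, φ p = 1 := fun p hp =>
    hone _ ((parabolicRescale_mem_Qcube hR).2 (by rwa [one_mul]))
  calc ∫ p in Qcube n R x₁ t₁, dirDeriv (timeDir n) u p ^ 2
      = ∫ p in Qcube n R x₁ t₁, φ p ^ 4 * dirDeriv (timeDir n) u p ^ 2 :=
        setIntegral_congr_fun (measurableSet_Qcube R x₁ t₁) fun p hp => by simp [hone' p hp]
    _ ≤ ∫ p, φ p ^ 4 * dirDeriv (timeDir n) u p ^ 2 :=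
        setIntegral_le_integral (h.integrable_sq_timeDeriv volume hu)
          (Filter.Eventually.of_forall fun p => by positivity)
    _ ≤ 20 * (M / R ^ 2) * ∫ p, φ p ^ 2 * ∑ i, dirDeriv (spaceDir n i) u p ^ 2 :=
        integral_sq_timeDeriv_le_energy volume h hu hA heat
    _ ≤ 20 * (M / R ^ 2) * (6 * (M / R ^ 2) * ∫ p in Qcube n (2 * R) x₁ t₁, u p ^ 2) := by
        gcongr
        exact caccioppoli_energy volume h hu heat (measurableSet_Qcube _ x₁ t₁)
          ((hu.continuous.pow 2).integrableOn_Qcube _ x₁ t₁)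
    _ = _ := by
        field_simp
        ring

lemma deriv_time_eq_dirDeriv {u : EuclideanSpace ℝ (Fin n) × ℝ → ℝ} (hu : ContDiff ℝ (⊤ : ℕ∞) u)
    (x : EuclideanSpace ℝ (Fin n)) (t : ℝ) :
    deriv (fun s => u (x, s)) t = dirDeriv (timeDir n) u (x, t) :=
  ((hu.differentiable (by simp) (x, t)).hasFDerivAt.comp_hasDerivAt t
    ((hasDerivAt_const t x).prodMk (hasDerivAt_id t))).deriv

lemma fderiv_space_eq_dirDeriv {u : EuclideanSpace ℝ (Fin n) × ℝ → ℝ}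
    (hu : ContDiff ℝ (⊤ : ℕ∞) u) (x : EuclideanSpace ℝ (Fin n)) (t : ℝ) (i : Fin n) :
    fderiv ℝ (fun y => u (y, t)) x (EuclideanSpace.single i 1) =
      dirDeriv (spaceDir n i) u (x, t) := by
  have h : HasFDerivAt (fun y => u (y, t)) _ x :=
    (hu.differentiable (by simp) (x, t)).hasFDerivAt.comp x (hasFDerivAt_prodMk_left x t)
  rw [h.fderiv]
  simp [dirDeriv, spaceDir]

lemma lap_eq_sum_dirDeriv {u : EuclideanSpace ℝ (Fin n) × ℝ → ℝ} (hu : ContDiff ℝ (⊤ : ℕ∞) u)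
    (x : EuclideanSpace ℝ (Fin n)) (t : ℝ) :
    lap n (fun y => u (y, t)) x =
      ∑ i, dirDeriv (spaceDir n i) (dirDeriv (spaceDir n i) u) (x, t) := by
  simp_rw [lap, fderiv_space_eq_dirDeriv hu, fderiv_space_eq_dirDeriv (hu.dirDeriv _)]

lemma heat_dirDeriv {u : EuclideanSpace ℝ (Fin n) × ℝ → ℝ} (hu : ContDiff ℝ (⊤ : ℕ∞) u)
    (heat : ∀ p, ∑ i, dirDeriv (spaceDir n i) (dirDeriv (spaceDir n i) u) p =
      dirDeriv (timeDir n) u p) (v p : EuclideanSpace ℝ (Fin n) × ℝ) :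
    ∑ i, dirDeriv (spaceDir n i) (dirDeriv (spaceDir n i) (dirDeriv v u)) p =
      dirDeriv (timeDir n) (dirDeriv v u) p := by
  have hcomm : ∀ i, dirDeriv (spaceDir n i) (dirDeriv v u) =
      dirDeriv v (dirDeriv (spaceDir n i) u) := fun i => funext (dirDeriv_comm hu _ _)
  simp_rw [hcomm, dirDeriv_comm (hu.dirDeriv _) _ v]
  rw [← dirDeriv_sum fun i => (hu.dirDeriv (spaceDir n i)).dirDeriv (spaceDir n i), funext heat,
    dirDeriv_comm hu]

end ParabolicCube

/-- there is `C₀ = C₀(n)` such that for any eternal smooth solution `u`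
of the heat equation on `ℝⁿ × ℝ`, any `k ≥ 1`, any `(x₁,t₁)` and `R > 0`,
`∫_{Q⁰_R} (∂_t^k u)² ≤ (C₀^k / R^{4k}) ∫_{Q⁰_{2^k R}} u²`. -/
theorem heat_time_derivative_L2_iterate (n : ℕ) :
    ∃ C₀ : ℝ, 0 < C₀ ∧
      ∀ u : EuclideanSpace ℝ (Fin n) × ℝ → ℝ,
        ContDiff ℝ (⊤ : ℕ∞) u →
        (∀ (x : EuclideanSpace ℝ (Fin n)) (t : ℝ),
          lap n (fun y => u (y, t)) x = deriv (fun s => u (x, s)) t) →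
        ∀ k : ℕ, 1 ≤ k →
          ∀ (x₁ : EuclideanSpace ℝ (Fin n)) (t₁ R : ℝ), 0 < R →
            (∫ p in Qcube n R x₁ t₁,
                (iteratedDeriv k (fun s => u (p.1, s)) p.2) ^ 2) ≤
              (C₀ ^ k / R ^ (4 * k)) *
                ∫ p in Qcube n (2 ^ k * R) x₁ t₁, (u p) ^ 2 := by
  obtain ⟨C, hC, hbase⟩ := exists_integral_sq_timeDeriv_le n
  refine ⟨C, hC, fun u hu hheat k _ x₁ t₁ R hR => ?_⟩
  have heat : ∀ p, ∑ i, dirDeriv (spaceDir n i) (dirDeriv (spaceDir n i) u) p =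
      dirDeriv (timeDir n) u p := fun p => by
    rw [← lap_eq_sum_dirDeriv hu p.1 p.2, hheat, deriv_time_eq_dirDeriv hu]
  clear hheat
  induction k generalizing u with
  | zero => simp
  | succ k ih =>
    have hderiv : ∀ x : EuclideanSpace ℝ (Fin n), deriv (fun s => u (x, s)) =
        fun s => dirDeriv (timeDir n) u (x, s) := fun x => funext (deriv_time_eq_dirDeriv hu x)
    simp_rw [iteratedDeriv_succ', hderiv]
    have h₁ := hbase u hu heat x₁ t₁ (2 ^ k * R) (by positivity)
    have h₂ : (C ^ k / R ^ (4 * k)) * (C / (2 ^ k * R) ^ 4) ≤ C ^ (k + 1) / R ^ (4 * (k + 1)) := by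
      have h₃ : (1 : ℝ) ≤ (2 ^ k) ^ 4 := one_le_pow₀ (one_le_pow₀ one_le_two)
      rw [div_mul_div_comm, ← pow_succ, mul_add, mul_one, pow_add R, mul_pow]
      gcongr
      exact le_mul_of_one_le_left (by positivity) h₃
    calc _ ≤ (C ^ k / R ^ (4 * k)) *
          ∫ p in Qcube n (2 ^ k * R) x₁ t₁, dirDeriv (timeDir n) u p ^ 2 := by
          rcases Nat.eq_zero_or_pos k with rfl | hk
          · simp
          · exact ih _ (hu.dirDeriv _) hk (heat_dirDeriv hu heat _)
      _ ≤ (C ^ k / R ^ (4 * k)) * (C / (2 ^ k * R) ^ 4 *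
          ∫ p in Qcube n (2 * (2 ^ k * R)) x₁ t₁, u p ^ 2) := by gcongr
      _ ≤ _ := by
          rw [← mul_assoc, ← mul_assoc 2, ← pow_succ']
          exact mul_le_mul_of_nonneg_right h₂ (integral_nonneg fun p => sq_nonneg _)
end
end

section
/- Let u be an ancient solution of the heat equation on ℝⁿ with polynomial growth of degree at most q ≥ 1, i.e. |u(x,t)| ≤ c₀(|x| + √|t| + 1)^q for all x ∈ ℝⁿ, t ≤ 0. If u(x,0) = 0 for all x ∈ ℝⁿ, then u is identically zero on ℝⁿ × (-∞,0]. -/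
open MeasureTheory Real

noncomputable section

lemma eq_zero_of_integral_mul_exp_inner_eq_zero {E : Type*} [NormedAddCommGroup E]
    [InnerProductSpace ℝ E] [FiniteDimensional ℝ E] [MeasurableSpace E] [BorelSpace E]
    {f : E → ℝ} (hf : Continuous f)
    (hint : ∀ y, Integrable (fun x ↦ f x * exp (inner ℝ x y)))
    (hzero : ∀ y, ∫ x, f x * exp (inner ℝ x y) = 0) : f = 0 := by
  have hnf : Continuous (fun x ↦ -f x) := hf.neg
  have hf0 : Integrable f := by simpa using hint 0
  have hmeas {g : E → ℝ} (hg : Continuous g) :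
      Measurable (fun x ↦ ENNReal.ofReal (g x)) := hg.measurable.ennreal_ofReal
  set μ : Measure E := volume.withDensity (fun x ↦ ENNReal.ofReal (f x)) with hμ
  set ν : Measure E := volume.withDensity (fun x ↦ ENNReal.ofReal (-f x)) with hν
  have : IsFiniteMeasure μ := isFiniteMeasure_withDensity_ofReal hf0.2
  have : IsFiniteMeasure ν := isFiniteMeasure_withDensity_ofReal hf0.neg.2
  have hintegral {g : E → ℝ} (hg : Continuous g) (h : E → ℝ) :
      ∫ x, h x ∂(volume.withDensity (fun x ↦ ENNReal.ofReal (g x))) = ∫ x, max (g x) 0 * h x := by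
    rw [integral_withDensity_eq_integral_toReal_smul (hmeas hg) (by simp)]
    simp [ENNReal.toReal_ofReal']
  have hintegrable {g : E → ℝ} (hg : Continuous g) (y : E)
      (hgi : Integrable (fun x ↦ g x * exp (inner ℝ x y))) :
      Integrable (fun x ↦ max (g x) 0 * exp (inner ℝ x y)) := by
    refine hgi.mono (by fun_prop) (.of_forall fun x ↦ ?_)
    simp only [norm_mul]
    gcongr
    rw [Real.norm_of_nonneg (le_max_right _ _)]
    exact max_le (le_abs_self _) (abs_nonneg _)
  have hneg (y : E) : Integrable (fun x ↦ -f x * exp (inner ℝ x y)) := by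
    simpa using (hint y).neg
  have hexp (y : E) : ∫ x, exp (inner ℝ x y) ∂μ = ∫ x, exp (inner ℝ x y) ∂ν := by
    rw [hμ, hν, hintegral hf, hintegral hnf, ← sub_eq_zero,
      ← integral_sub (hintegrable hf y (hint y)) (hintegrable hnf y (hneg y))]
    refine Eq.trans (integral_congr_ae (.of_forall fun x ↦ ?_)) (hzero y)
    dsimp only
    rw [← sub_mul]
    congr 1
    rcases le_total (f x) 0 with h | h <;> simp [h]
  have hmass : μ = 0 ↔ ν = 0 := by
    have h := hexp 0
    simp only [inner_zero_right, exp_zero, integral_const, smul_eq_mul, mul_one] at h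
    rw [← Measure.measure_univ_eq_zero, ← Measure.measure_univ_eq_zero, ← measureReal_eq_zero_iff,
      ← measureReal_eq_zero_iff, h]
  have hmgf (y : E) : ProbabilityTheory.mgf (fun x ↦ inner ℝ x y) μ
      = ProbabilityTheory.mgf (fun x ↦ inner ℝ x y) ν := by
    ext t
    simpa [ProbabilityTheory.mgf, inner_smul_right] using hexp (t • y)
  have hset (y : E) :
      ProbabilityTheory.integrableExpSet (fun x ↦ inner ℝ x y) μ = Set.univ := by
    refine Set.eq_univ_of_forall fun t ↦ ?_
    change Integrable _ μ
    rw [hμ, integrable_withDensity_iff_integrable_smul' (hmeas hf) (by simp)]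
    simpa [ENNReal.toReal_ofReal', inner_smul_right] using hintegrable hf (t • y) (hint _)
  have hμν : μ = ν := by
    refine Measure.ext_of_charFun (funext fun y ↦ ?_)
    have h := ProbabilityTheory.eqOn_complexMGF_of_mgf' (hmgf y) hmass
      (x := Complex.I) (by simp [hset])
    simpa [ProbabilityTheory.complexMGF, charFun_apply, mul_comm] using h
  have hae : f =ᵐ[volume] 0 := by
    have h := (withDensity_eq_iff (hmeas hf).aemeasurable (hmeas hnf).aemeasurable
      (by simpa [hμ] using measure_ne_top μ Set.univ)).1 hμν
    filter_upwards [h] with x hx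
    rcases le_total (f x) 0 with h | h
    · rw [ENNReal.ofReal_of_nonpos h, eq_comm, ENNReal.ofReal_eq_zero] at hx
      exact le_antisymm h (neg_nonpos.1 hx)
    · rw [ENNReal.ofReal_of_nonpos (p := -f x) (neg_nonpos.2 h), ENNReal.ofReal_eq_zero] at hx
      exact le_antisymm hx h
  exact (hf.ae_eq_iff_eq volume continuous_zero).1 hae

lemma integrable_exp_neg_mul_sq_norm_add_inner {E : Type*} [NormedAddCommGroup E]
    [InnerProductSpace ℝ E] [FiniteDimensional ℝ E] [MeasurableSpace E] [BorelSpace E]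
    {b : ℝ} (hb : 0 < b) (w : E) :
    Integrable (fun x : E ↦ exp (-b * ‖x‖ ^ 2 + inner ℝ w x)) := by
  have h := (GaussianFourier.integrable_cexp_neg_mul_sq_norm_add (V := E) (b := b)
    (by simpa using hb) 1 w).norm
  refine h.congr (.of_forall fun x ↦ ?_)
  simp only [Complex.norm_exp]
  norm_cast
  simp

lemma add_le_mul_exp_mul_sq {a η : ℝ} (ha : 0 ≤ a) (hη : 0 < η) (r : ℝ) :
    r + a ≤ (a + 1 / (4 * η) + 1) * exp (η * r ^ 2) := by
  have h1 : η * r ^ 2 + 1 ≤ exp (η * r ^ 2) := add_one_le_exp _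
  have h2 : r ≤ 1 / (4 * η) + η * r ^ 2 := by
    have : 1 / (4 * η) + η * r ^ 2 - r = (2 * η * r - 1) ^ 2 / (4 * η) := by field_simp; ring
    have : 0 ≤ (2 * η * r - 1) ^ 2 / (4 * η) := by positivity
    linarith
  have h3 : 0 ≤ η * r ^ 2 := by positivity
  have h4 : 0 < 1 / (4 * η) := by positivity
  nlinarith

lemma hasDerivAt_integral_of_compact {E : Type*} [NormedAddCommGroup E]
    [MeasurableSpace E] [BorelSpace E] {μ : Measure E} [IsFiniteMeasureOnCompacts μ]
    {s : Set ℝ} (hs : IsOpen s) {K : Set E} (hK : IsCompact K) {F F' : ℝ → E → ℝ}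
    (hF : ∀ t ∈ s, Continuous (F t))
    (hF' : ContinuousOn (fun p : ℝ × E ↦ F' p.1 p.2) (s ×ˢ Set.univ))
    (hFK : ∀ t, ∀ x ∉ K, F t x = 0) (hFK' : ∀ t, ∀ x ∉ K, F' t x = 0)
    (hd : ∀ t ∈ s, ∀ x, HasDerivAt (F · x) (F' t x) t) {t₀ : ℝ} (ht₀ : t₀ ∈ s) :
    HasDerivAt (fun t ↦ ∫ x, F t x ∂μ) (∫ x, F' t₀ x ∂μ) t₀ := by
  obtain ⟨r, hr, hrs⟩ := Metric.nhds_basis_closedBall.mem_iff.1 (hs.mem_nhds ht₀)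
  obtain ⟨C, hC⟩ := ((isCompact_closedBall t₀ r).prod hK).exists_bound_of_continuousOn
    (hF'.mono (Set.prod_mono hrs (Set.subset_univ _)))
  have hcont (t) (ht : t ∈ s) : Continuous (F' t) :=
    continuousOn_univ.1 (hF'.comp (f := fun x ↦ (t, x)) (by fun_prop) fun x _ ↦ ⟨ht, trivial⟩)
  refine (hasDerivAt_integral_of_dominated_loc_of_deriv_le
    (Metric.closedBall_mem_nhds t₀ hr) (bound := K.indicator fun _ ↦ C) ?_ ?_ ?_ ?_ ?_ ?_).2
  · filter_upwards [hs.mem_nhds ht₀] with t ht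
    exact ((hF t ht).stronglyMeasurable_of_hasCompactSupport
      (HasCompactSupport.intro hK (hFK t))).aestronglyMeasurable
  · exact (hF t₀ ht₀).integrable_of_hasCompactSupport (HasCompactSupport.intro hK (hFK t₀))
  · exact ((hcont t₀ ht₀).stronglyMeasurable_of_hasCompactSupport
      (HasCompactSupport.intro hK (hFK' t₀))).aestronglyMeasurable
  · refine .of_forall fun x t ht ↦ ?_
    by_cases hx : x ∈ K
    · simpa [hx] using hC (t, x) ⟨ht, hx⟩
    · simp [hx, hFK' t x hx]
  · exact (integrable_indicator_iff hK.measurableSet).2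
      (integrableOn_const hK.measure_lt_top.ne)
  · exact .of_forall fun x t ht ↦ hd t (hrs ht) x

lemma contDiff_fderiv_apply {E F : Type*} [NormedAddCommGroup E] [NormedSpace ℝ E]
    [NormedAddCommGroup F] [NormedSpace ℝ F] {f : E → F} (hf : ContDiff ℝ (⊤ : ℕ∞) f) (v : E) :
    ContDiff ℝ (⊤ : ℕ∞) (fun x ↦ fderiv ℝ f x v) :=
  (hf.fderiv_right (m := (⊤ : ℕ∞)) (by simp)).clm_apply contDiff_const

lemma continuous_lap {n : ℕ} {f : EuclideanSpace ℝ (Fin n) → ℝ}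
    (hf : ContDiff ℝ (⊤ : ℕ∞) f) : Continuous (lap n f) :=
  continuous_finsetSum _ fun _ _ ↦
    (contDiff_fderiv_apply (contDiff_fderiv_apply hf _) _).continuous

lemma lap_mul {n : ℕ} {f g : EuclideanSpace ℝ (Fin n) → ℝ}
    (hf : ContDiff ℝ (⊤ : ℕ∞) f) (hg : ContDiff ℝ (⊤ : ℕ∞) g) (x : EuclideanSpace ℝ (Fin n)) :
    lap n (fun y ↦ f y * g y) x = lap n f x * g x
      + 2 * ∑ i, fderiv ℝ f x (EuclideanSpace.single i 1) * fderiv ℝ g x (EuclideanSpace.single i 1)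
      + f x * lap n g x := by
  have hd {f : EuclideanSpace ℝ (Fin n) → ℝ} (hf : ContDiff ℝ (⊤ : ℕ∞) f) : Differentiable ℝ f :=
    hf.differentiable (by simp)
  have hmul {f g : EuclideanSpace ℝ (Fin n) → ℝ} (hf : ContDiff ℝ (⊤ : ℕ∞) f)
      (hg : ContDiff ℝ (⊤ : ℕ∞) g) (y v) : fderiv ℝ (fun y ↦ f y * g y) y v
        = f y * fderiv ℝ g y v + g y * fderiv ℝ f y v := by
    rw [fderiv_fun_mul (hd hf y) (hd hg y)]
    simp
  simp only [lap, Finset.sum_mul, Finset.mul_sum, ← Finset.sum_add_distrib]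
  refine Finset.sum_congr rfl fun i _ ↦ ?_
  have hf' := contDiff_fderiv_apply hf (EuclideanSpace.single i 1)
  have hg' := contDiff_fderiv_apply hg (EuclideanSpace.single i 1)
  simp only [hmul hf hg]
  rw [fderiv_fun_add (hd (hf.mul hg') x) (hd (hg.mul hf') x)]
  simp only [add_apply, hmul hf hg', hmul hg hf']
  ring

lemma hasCompactSupport_lap {n : ℕ} {f : EuclideanSpace ℝ (Fin n) → ℝ}
    (hf : HasCompactSupport f) : HasCompactSupport (lap n f) := by
  refine HasCompactSupport.intro hf.isCompact fun x hx ↦ Finset.sum_eq_zero fun i _ ↦ ?_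
  have h₁ := tsupport_fderiv_apply_subset ℝ (f := f) (EuclideanSpace.single i 1)
  have h₂ := tsupport_fderiv_apply_subset ℝ
    (f := fun y ↦ fderiv ℝ f y (EuclideanSpace.single i 1)) (EuclideanSpace.single i 1)
  exact image_eq_zero_of_notMem_tsupport (f := fun x ↦ fderiv ℝ (fun y ↦ fderiv ℝ f y
    (EuclideanSpace.single i 1)) x (EuclideanSpace.single i 1)) (mt (fun h ↦ h₁ (h₂ h)) hx)

lemma integral_lap_mul {n : ℕ} {f g : EuclideanSpace ℝ (Fin n) → ℝ}
    (hf : ContDiff ℝ (⊤ : ℕ∞) f) (hg : ContDiff ℝ (⊤ : ℕ∞) g) (hgc : HasCompactSupport g) :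
    ∫ x, lap n f x * g x = ∫ x, f x * lap n g x := by
  have hi {f g : EuclideanSpace ℝ (Fin n) → ℝ} (hf : ContDiff ℝ (⊤ : ℕ∞) f)
      (hg : ContDiff ℝ (⊤ : ℕ∞) g) (hgc : HasCompactSupport g) :
      Integrable (fun x ↦ f x * g x) :=
    (hf.continuous.mul hg.continuous).integrable_of_hasCompactSupport hgc.mul_left
  have hparts {f g : EuclideanSpace ℝ (Fin n) → ℝ} (hf : ContDiff ℝ (⊤ : ℕ∞) f)
      (hg : ContDiff ℝ (⊤ : ℕ∞) g) (hgc : HasCompactSupport g) (v) :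
      ∫ x, f x * fderiv ℝ g x v = -∫ x, fderiv ℝ f x v * g x :=
    integral_mul_fderiv_eq_neg_fderiv_mul_of_integrable
      (hi (contDiff_fderiv_apply hf v) hg hgc)
      (hi hf (contDiff_fderiv_apply hg v) (hgc.fderiv_apply ℝ v))
      (hi hf hg hgc) (fun x _ ↦ hf.differentiable (by simp) x)
      (fun x _ ↦ hg.differentiable (by simp) x)
  simp only [lap, Finset.sum_mul, Finset.mul_sum]
  rw [integral_finsetSum, integral_finsetSum]
  · refine Finset.sum_congr rfl fun i _ ↦ ?_
    have hf' := contDiff_fderiv_apply hf (EuclideanSpace.single i 1)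
    have hg' := contDiff_fderiv_apply hg (EuclideanSpace.single i 1)
    have hgc' := hgc.fderiv_apply ℝ (EuclideanSpace.single i 1)
    rw [hparts hf hg' hgc', ← neg_eq_iff_eq_neg.2 (hparts hf' hg hgc _)]
  · exact fun i _ ↦ hi hf (contDiff_fderiv_apply (contDiff_fderiv_apply hg _) _)
      ((hgc.fderiv_apply ℝ _).fderiv_apply ℝ _)
  · exact fun i _ ↦ hi (contDiff_fderiv_apply (contDiff_fderiv_apply hf _) _) hg hgc

lemma fderiv_comp_smul_apply {E : Type*} [NormedAddCommGroup E] [NormedSpace ℝ E]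
    (f : E → ℝ) (c : ℝ) (x v : E) :
    fderiv ℝ (fun y ↦ f (c • y)) x v = c * fderiv ℝ f (c • x) v := by
  rw [fderiv_comp_smul]
  simp

lemma lap_comp_smul {n : ℕ} {f : EuclideanSpace ℝ (Fin n) → ℝ} (hf : ContDiff ℝ (⊤ : ℕ∞) f)
    (c : ℝ) (x : EuclideanSpace ℝ (Fin n)) :
    lap n (fun y ↦ f (c • y)) x = c ^ 2 * lap n f (c • x) := by
  simp only [lap, fderiv_comp_smul_apply, Finset.mul_sum]
  refine Finset.sum_congr rfl fun i _ ↦ ?_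
  have hf' := contDiff_fderiv_apply hf (EuclideanSpace.single i 1)
  have hd : DifferentiableAt ℝ
      (fun y ↦ fderiv ℝ f (c • y) (EuclideanSpace.single i 1)) x :=
    (hf'.comp (contDiff_const_smul c)).differentiable (by simp) x
  rw [fderiv_const_mul hd]
  rw [smul_apply,
    fderiv_comp_smul_apply (fun y ↦ fderiv ℝ f y (EuclideanSpace.single i 1))]
  simp only [smul_eq_mul]
  ring

/-- The backward heat kernel on `ℝⁿ` with pole at `(0, 1)`, up to normalization. -/
def backwardHeatKernel (n : ℕ) (t : ℝ) (x : EuclideanSpace ℝ (Fin n)) : ℝ :=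
  (1 - t) ^ (-(n : ℝ) / 2) * exp (-‖x‖ ^ 2 / (4 * (1 - t)))

lemma contDiff_backwardHeatKernel (n : ℕ) (t : ℝ) :
    ContDiff ℝ (⊤ : ℕ∞) (backwardHeatKernel n t) := by
  unfold backwardHeatKernel
  have := contDiff_norm_sq ℝ (E := EuclideanSpace ℝ (Fin n)) (n := (⊤ : ℕ∞))
  fun_prop

lemma fderiv_backwardHeatKernel (n : ℕ) (t : ℝ) (x : EuclideanSpace ℝ (Fin n)) (i : Fin n) :
    fderiv ℝ (backwardHeatKernel n t) x (EuclideanSpace.single i 1)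
      = -(x i) / (2 * (1 - t)) * backwardHeatKernel n t x := by
  have h := (((hasStrictFDerivAt_norm_sq x).hasFDerivAt.fun_neg.mul_const
    (4 * (1 - t))⁻¹).exp.const_mul ((1 - t) ^ (-(n : ℝ) / 2))).fderiv
  simp only [← div_eq_mul_inv] at h
  unfold backwardHeatKernel
  rw [h]
  generalize 1 - t = τ
  simp [EuclideanSpace.inner_single_right]
  ring

lemma lap_backwardHeatKernel (n : ℕ) {t : ℝ} (ht : t < 1) (x : EuclideanSpace ℝ (Fin n)) :
    lap n (backwardHeatKernel n t) x
      = (‖x‖ ^ 2 / (4 * (1 - t) ^ 2) - n / (2 * (1 - t))) * backwardHeatKernel n t x := by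
  have ht' : 1 - t ≠ 0 := by linarith
  have hi (i : Fin n) : fderiv ℝ (fun y ↦ fderiv ℝ (backwardHeatKernel n t) y
        (EuclideanSpace.single i 1)) x (EuclideanSpace.single i 1)
      = (x i ^ 2 / (4 * (1 - t) ^ 2) - 1 / (2 * (1 - t))) * backwardHeatKernel n t x := by
    simp only [fderiv_backwardHeatKernel]
    have h1 : HasFDerivAt (fun y : EuclideanSpace ℝ (Fin n) ↦ -(y i) / (2 * (1 - t)))
        ((2 * (1 - t))⁻¹ • -(EuclideanSpace.proj i : EuclideanSpace ℝ (Fin n) →L[ℝ] ℝ)) x := by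
      simp only [div_eq_mul_inv]
      exact (EuclideanSpace.proj i : EuclideanSpace ℝ (Fin n) →L[ℝ] ℝ).hasFDerivAt.neg.mul_const _
    have h2 := ((contDiff_backwardHeatKernel n t).differentiable (by simp) x).hasFDerivAt
    rw [(h1.fun_mul h2).fderiv]
    simp [fderiv_backwardHeatKernel]
    field_simp
    ring
  simp only [lap, hi, ← Finset.sum_mul, Finset.sum_sub_distrib, ← Finset.sum_div,
    EuclideanSpace.norm_sq_eq, Real.norm_eq_abs, sq_abs]
  simp [div_eq_mul_inv]

lemma hasDerivAt_backwardHeatKernel (n : ℕ) {t : ℝ} (ht : t < 1) (x : EuclideanSpace ℝ (Fin n)) :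
    HasDerivAt (fun s ↦ backwardHeatKernel n s x) (-lap n (backwardHeatKernel n t) x) t := by
  have ht' : 0 < 1 - t := by linarith
  rw [lap_backwardHeatKernel n ht]
  have h1 : HasDerivAt (fun s : ℝ ↦ 1 - s) (-1) t := by
    simpa using (hasDerivAt_id t).const_sub 1
  have h2 := h1.rpow_const (p := -(n : ℝ) / 2) (.inl ht'.ne')
  have h3 := ((hasDerivAt_const t (-‖x‖ ^ 2)).div (h1.const_mul 4) (by positivity)).exp
  refine (h2.mul h3).congr_deriv ?_
  rw [rpow_sub_one ht'.ne', backwardHeatKernel]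
  simp
  field_simp
  ring

lemma continuousOn_backwardHeatKernel (n : ℕ) :
    ContinuousOn (fun p : ℝ × EuclideanSpace ℝ (Fin n) ↦ backwardHeatKernel n p.1 p.2)
      (Set.Iio 1 ×ˢ Set.univ) := by
  have h : ∀ p ∈ Set.Iio (1 : ℝ) ×ˢ (Set.univ : Set (EuclideanSpace ℝ (Fin n))), 1 - p.1 ≠ 0 :=
    fun p hp ↦ (sub_pos.2 hp.1).ne'
  unfold backwardHeatKernel
  refine ContinuousOn.mul (ContinuousOn.rpow_const (by fun_prop) fun p hp ↦ .inl (h p hp))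
    (ContinuousOn.rexp (ContinuousOn.div (by fun_prop) (by fun_prop) fun p hp ↦ ?_))
  simpa using h p hp

lemma backwardHeatKernel_nonneg (n : ℕ) {t : ℝ} (ht : t ≤ 0) (x : EuclideanSpace ℝ (Fin n)) :
    0 ≤ backwardHeatKernel n t x :=
  mul_nonneg (rpow_nonneg (by linarith) _) (exp_nonneg _)

lemma backwardHeatKernel_le (n : ℕ) {s t : ℝ} (hst : s ≤ t) (ht : t ≤ 0)
    (x : EuclideanSpace ℝ (Fin n)) :
    backwardHeatKernel n t x ≤ exp (-‖x‖ ^ 2 / (4 * (1 - s))) := by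
  have h1 : (1 - t) ^ (-(n : ℝ) / 2) ≤ 1 :=
    rpow_le_one_of_one_le_of_nonpos (by linarith)
      (div_nonpos_of_nonpos_of_nonneg (by simp) (by norm_num))
  have h2 : exp (-‖x‖ ^ 2 / (4 * (1 - t))) ≤ exp (-‖x‖ ^ 2 / (4 * (1 - s))) := by
    have : 0 < 1 - t := by linarith
    rw [exp_le_exp, neg_div, neg_div, neg_le_neg_iff]
    gcongr
  exact (mul_le_of_le_one_left (exp_nonneg _) h1).trans h2

lemma abs_lap_backwardHeatKernel_mul_cutoff_sub_le {n : ℕ} {χ : EuclideanSpace ℝ (Fin n) → ℝ}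
    (hχ : ContDiff ℝ (⊤ : ℕ∞) χ) {M : ℝ}
    (hM : ∀ x i, |fderiv ℝ χ x (EuclideanSpace.single i 1)| ≤ M) (hM' : ∀ x, |lap n χ x| ≤ M)
    {s t ε : ℝ} (hst : s ≤ t) (ht : t ≤ 0) (hε : 0 ≤ ε) (hε1 : ε ≤ 1)
    (x : EuclideanSpace ℝ (Fin n)) :
    |lap n (fun y ↦ backwardHeatKernel n t y * χ (ε • y)) x
        - lap n (backwardHeatKernel n t) x * χ (ε • x)|
      ≤ ε * M * ((n * ‖x‖ + 1) * exp (-‖x‖ ^ 2 / (4 * (1 - s)))) := by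
  have hM0 : 0 ≤ M := (abs_nonneg _).trans (hM' 0)
  have hW0 := backwardHeatKernel_nonneg n ht x
  have hW1 := backwardHeatKernel_le n hst ht x
  set W := backwardHeatKernel n t x with hW
  rw [lap_mul (g := fun y ↦ χ (ε • y)) (contDiff_backwardHeatKernel n t)
      (hχ.comp (contDiff_const_smul ε)),
    lap_comp_smul hχ, Finset.mul_sum]
  simp only [fderiv_comp_smul_apply, fderiv_backwardHeatKernel, ← hW]
  have hsum : |∑ i : Fin n, 2 * (-(x i) / (2 * (1 - t)) * W *
      (ε * fderiv ℝ χ (ε • x) (EuclideanSpace.single i 1)))| ≤ n * (‖x‖ * W * (ε * M)) := by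
    refine (Finset.abs_sum_le_sum_abs _ _).trans ?_
    refine (Finset.sum_le_card_nsmul _ _ (‖x‖ * W * (ε * M)) fun i _ ↦ ?_).trans (by simp)
    have h1 : |2 * (-(x i) / (2 * (1 - t)))| ≤ ‖x‖ := by
      have : 2 * (-(x i) / (2 * (1 - t))) = -(x i) / (1 - t) := by
        field_simp
      rw [this, abs_div, abs_neg, abs_of_pos (a := 1 - t) (by linarith)]
      exact (div_le_self (abs_nonneg _) (by linarith)).trans (PiLp.norm_apply_le x i)
    rw [mul_assoc (-(x i) / _), ← mul_assoc 2, ← mul_assoc, abs_mul, abs_mul, abs_mul ε,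
      abs_of_nonneg hW0, abs_of_nonneg hε]
    gcongr
    exact hM _ _
  have hlap : |W * (ε ^ 2 * lap n χ (ε • x))| ≤ W * (ε * M) := by
    rw [abs_mul, abs_mul, abs_of_nonneg hW0, abs_of_nonneg (sq_nonneg ε)]
    gcongr
    · nlinarith
    · exact hM' _
  calc _ = |(∑ i : Fin n, 2 * (-(x i) / (2 * (1 - t)) * W *
      (ε * fderiv ℝ χ (ε • x) (EuclideanSpace.single i 1)))) + W * (ε ^ 2 * lap n χ (ε • x))| := by
        congr 1
        ring
    _ ≤ n * (‖x‖ * W * (ε * M)) + W * (ε * M) := (abs_add_le _ _).trans (add_le_add hsum hlap)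
    _ = ε * M * ((n * ‖x‖ + 1) * W) := by ring
    _ ≤ _ := by gcongr

lemma IsAncientHeat.hasDerivAt {n : ℕ} {u : EuclideanSpace ℝ (Fin n) × ℝ → ℝ}
    (hu : IsAncientHeat n u) (x : EuclideanSpace ℝ (Fin n)) (t : ℝ) :
    HasDerivAt (fun s ↦ u (x, s)) (fderiv ℝ u (x, t) (0, 1)) t :=
  (hu.1.differentiable (by simp) (x, t)).hasFDerivAt.comp_hasDerivAt t
    ((hasDerivAt_const t x).prodMk (hasDerivAt_id t))

lemma IsAncientHeat.hasDerivAt_integral_mul_cutoff {n : ℕ}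
    {u : EuclideanSpace ℝ (Fin n) × ℝ → ℝ} (hu : IsAncientHeat n u)
    {χ : EuclideanSpace ℝ (Fin n) → ℝ} (hχ : ContDiff ℝ (⊤ : ℕ∞) χ) (hχc : HasCompactSupport χ)
    {t : ℝ} (ht : t ≤ 0) :
    HasDerivAt (fun t ↦ ∫ x, u (x, t) * (backwardHeatKernel n t x * χ x))
      (∫ x, u (x, t) * (lap n (fun y ↦ backwardHeatKernel n t y * χ y) x
        - lap n (backwardHeatKernel n t) x * χ x)) t := by
  set F' : ℝ → EuclideanSpace ℝ (Fin n) → ℝ := fun t x ↦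
    fderiv ℝ u (x, t) (0, 1) * (backwardHeatKernel n t x * χ x)
      + u (x, t) * (-lap n (backwardHeatKernel n t) x * χ x) with hF'
  have hut (t : ℝ) : ContDiff ℝ (⊤ : ℕ∞) (fun x ↦ u (x, t)) := hu.1.comp (by fun_prop)
  have hW (t : ℝ) := contDiff_backwardHeatKernel n t
  have hzero (x) (hx : x ∉ tsupport χ) : χ x = 0 := image_eq_zero_of_notMem_tsupport hx
  have hWχ : HasCompactSupport (fun y ↦ backwardHeatKernel n t y * χ y) := hχc.mul_left
  have hderiv : HasDerivAt (fun t ↦ ∫ x, u (x, t) * (backwardHeatKernel n t x * χ x))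
      (∫ x, F' t x) t := by
    refine hasDerivAt_integral_of_compact (s := Set.Iio 1) isOpen_Iio hχc.isCompact
      (fun t _ ↦ (hut t).continuous.mul ((hW t).continuous.mul hχ.continuous)) ?_ ?_ ?_ ?_
      (ht.trans_lt one_pos)
    · have h1 : Continuous (fun p : ℝ × EuclideanSpace ℝ (Fin n) ↦
          fderiv ℝ u (p.2, p.1) (0, 1)) :=
        (contDiff_fderiv_apply hu.1 (0, 1)).continuous.comp (by fun_prop)
      have h2 : Continuous (fun p : ℝ × EuclideanSpace ℝ (Fin n) ↦ u (p.2, p.1)) :=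
        hu.1.continuous.comp (by fun_prop)
      have h3 : Continuous (fun p : ℝ × EuclideanSpace ℝ (Fin n) ↦ χ p.2) :=
        hχ.continuous.comp (by fun_prop)
      have h4 : ContinuousOn (fun p : ℝ × EuclideanSpace ℝ (Fin n) ↦
          lap n (backwardHeatKernel n p.1) p.2) (Set.Iio 1 ×ˢ Set.univ) := by
        refine ContinuousOn.congr (ContinuousOn.mul ?_ (continuousOn_backwardHeatKernel n))
          fun p hp ↦ lap_backwardHeatKernel n hp.1 p.2
        have h : ∀ p ∈ Set.Iio (1 : ℝ) ×ˢ (Set.univ : Set (EuclideanSpace ℝ (Fin n))),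
          1 - p.1 ≠ 0 := fun p hp ↦ (sub_pos.2 hp.1).ne'
        refine ContinuousOn.sub (ContinuousOn.div (by fun_prop) (by fun_prop) fun p hp ↦ ?_)
          (ContinuousOn.div (by fun_prop) (by fun_prop) fun p hp ↦ ?_)
        · simpa using h p hp
        · simpa using h p hp
      exact (h1.continuousOn.mul ((continuousOn_backwardHeatKernel n).mul h3.continuousOn)).add
        (h2.continuousOn.mul (h4.neg.mul h3.continuousOn))
    · intro t x hx
      simp [hzero x hx]
    · intro t x hx
      simp [hF', hzero x hx]
    · exact fun t ht x ↦
        (hu.hasDerivAt x t).mul ((hasDerivAt_backwardHeatKernel n ht x).mul_const (χ x))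
  refine hderiv.congr_deriv ?_
  have hint {f g : EuclideanSpace ℝ (Fin n) → ℝ} (hf : Continuous f) (hg : Continuous g) :
      Integrable (fun x ↦ f x * (g x * χ x)) :=
    (hf.mul (hg.mul hχ.continuous)).integrable_of_hasCompactSupport hχc.mul_left.mul_left
  have hlap : Integrable (fun x ↦ u (x, t) * lap n (fun y ↦ backwardHeatKernel n t y * χ y) x) :=
    ((hut t).continuous.mul (continuous_lap ((hW t).mul hχ))).integrable_of_hasCompactSupport
      (HasCompactSupport.mul_left (hasCompactSupport_lap hWχ))
  have hfst : ∫ x, fderiv ℝ u (x, t) (0, 1) * (backwardHeatKernel n t x * χ x)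
      = ∫ x, u (x, t) * lap n (fun y ↦ backwardHeatKernel n t y * χ y) x := by
    rw [← integral_lap_mul (hut t) ((hW t).mul hχ) hWχ]
    congr 1 with x
    rw [hu.2 x t ht, (hu.hasDerivAt x t).deriv]
  have hut' : Continuous (fun x ↦ fderiv ℝ u (x, t) (0, 1)) :=
    (contDiff_fderiv_apply hu.1 (0, 1)).continuous.comp (by fun_prop)
  simp only [hF', mul_sub]
  rw [integral_add (hint hut' (hW t).continuous)
      (hint (hut t).continuous (continuous_lap (hW t)).fun_neg),
    integral_sub hlap (hint (hut t).continuous (continuous_lap (hW t))), hfst, sub_eq_add_neg,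
    ← integral_neg]
  simp

lemma integrable_exp_neg_mul_sq_norm {n : ℕ} {b : ℝ} (hb : 0 < b) :
    Integrable (fun x : EuclideanSpace ℝ (Fin n) ↦ exp (-b * ‖x‖ ^ 2)) := by
  simpa using integrable_exp_neg_mul_sq_norm_add_inner hb (0 : EuclideanSpace ℝ (Fin n))

lemma IsAncientHeat.integral_mul_backwardHeatKernel_eq_zero {n : ℕ}
    {u : EuclideanSpace ℝ (Fin n) × ℝ → ℝ} (hu : IsAncientHeat n u) {s A : ℝ} (hs : s ≤ 0)
    (hgr : ∀ x t, s ≤ t → t ≤ 0 → |u (x, t)| ≤ A * exp (‖x‖ ^ 2 / (16 * (1 - s))))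
    (h0 : ∀ x, u (x, 0) = 0) :
    ∫ x, u (x, s) * backwardHeatKernel n s x = 0 := by
  have hA : 0 ≤ A := by
    have h := (abs_nonneg _).trans (hgr 0 s le_rfl hs)
    simpa using h
  have hs1 : 0 < 1 - s := by linarith
  set δ : ℝ := 1 / (16 * (1 - s)) with hδ
  have hδ0 : 0 < δ := by positivity
  have hgr' (x t) (hst : s ≤ t) (ht : t ≤ 0) : |u (x, t)| ≤ A * exp (δ * ‖x‖ ^ 2) := by
    refine (hgr x t hst ht).trans_eq ?_
    rw [hδ]
    ring_nf
  have hexp (r : ℝ) : exp (-r ^ 2 / (4 * (1 - s))) = exp (-(4 * δ) * r ^ 2) := by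
    rw [hδ]
    congr 1
    field_simp
    norm_num
  have hexp_add (a b r : ℝ) : exp (a * r ^ 2) * exp (b * r ^ 2) = exp ((a + b) * r ^ 2) := by
    rw [← exp_add, add_mul]
  have hlin (r : ℝ) (hr : 0 ≤ r) :
      n * r + 1 ≤ (n + 1) * (1 + 1 / (4 * δ) + 1) * exp (δ * r ^ 2) := by
    have h := add_le_mul_exp_mul_sq zero_le_one hδ0 r
    have hn : (0 : ℝ) ≤ n := n.cast_nonneg
    calc n * r + 1 ≤ (n + 1) * (r + 1) := by nlinarith
      _ ≤ _ := by rw [mul_assoc]; gcongr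
  let φ : ContDiffBump (0 : EuclideanSpace ℝ (Fin n)) := ⟨1, 2, one_pos, one_lt_two⟩
  have hφ : ContDiff ℝ (⊤ : ℕ∞) φ := φ.contDiff
  obtain ⟨M, hM, hM'⟩ : ∃ M, (∀ x i, |fderiv ℝ φ x (EuclideanSpace.single i 1)| ≤ M) ∧
      ∀ x, |lap n φ x| ≤ M := by
    choose C hC using fun i : Fin n ↦
      (φ.hasCompactSupport.fderiv_apply ℝ
        (EuclideanSpace.single i (1 : ℝ))).exists_bound_of_continuous
        (contDiff_fderiv_apply hφ _).continuous
    obtain ⟨C', hC'⟩ := (hasCompactSupport_lap φ.hasCompactSupport).exists_bound_of_continuous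
      (continuous_lap hφ)
    refine ⟨(∑ i, |C i|) + |C'|, fun x i ↦ ?_, fun x ↦ ?_⟩
    · have := Finset.single_le_sum (f := fun i ↦ |C i|) (fun i _ ↦ abs_nonneg _)
        (Finset.mem_univ i)
      linarith [hC i x, le_abs_self (C i), abs_nonneg C',
        Real.norm_eq_abs (fderiv ℝ φ x (EuclideanSpace.single i 1))]
    · have : 0 ≤ ∑ i, |C i| := Finset.sum_nonneg fun i _ ↦ abs_nonneg _
      linarith [hC' x, le_abs_self C', Real.norm_eq_abs (lap n φ x)]
  have hM0 : 0 ≤ M := (abs_nonneg _).trans (hM' 0)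
  set I : ℝ → ℝ → ℝ := fun ε t ↦ ∫ x, u (x, t) * (backwardHeatKernel n t x * φ (ε • x)) with hI
  set L : ℝ := (n + 1) * (1 + 1 / (4 * δ) + 1) with hL
  set J : ℝ := ∫ x : EuclideanSpace ℝ (Fin n), exp (-(2 * δ) * ‖x‖ ^ 2)
  have hbound (ε : ℝ) (hε : 0 < ε) (hε1 : ε ≤ 1) : |I ε s| ≤ ε * (A * M * L * J * |s|) := by
    have hφε : ContDiff ℝ (⊤ : ℕ∞) (fun x : EuclideanSpace ℝ (Fin n) ↦ φ (ε • x)) :=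
      hφ.comp (contDiff_const_smul ε)
    have hφεc : HasCompactSupport (fun x : EuclideanSpace ℝ (Fin n) ↦ φ (ε • x)) :=
      φ.hasCompactSupport.comp_smul hε.ne'
    have hderiv (t : ℝ) (ht : t ∈ Set.Icc s 0) :=
      (hu.hasDerivAt_integral_mul_cutoff hφε hφεc ht.2).hasDerivWithinAt (s := Set.Icc s 0)
    have h := (convex_Icc s 0).norm_image_sub_le_of_norm_hasDerivWithin_le
      (C := ε * (A * M * L) * J) hderiv (fun t ht ↦ ?_) (Set.right_mem_Icc.2 hs)
      (Set.left_mem_Icc.2 hs)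
    · simp only [h0, zero_mul, integral_zero, sub_zero] at h
      refine h.trans_eq ?_
      rw [Real.norm_eq_abs]
      ring
    · rw [← integral_const_mul]
      refine norm_integral_le_of_norm_le
        ((integrable_exp_neg_mul_sq_norm (by positivity)).const_mul _) (.of_forall fun x ↦ ?_)
      rw [norm_mul]
      calc _ ≤ A * exp (δ * ‖x‖ ^ 2) *
            (ε * M * ((n * ‖x‖ + 1) * exp (-‖x‖ ^ 2 / (4 * (1 - s))))) := by
            gcongr
            · exact hgr' x t ht.1 ht.2
            · exact abs_lap_backwardHeatKernel_mul_cutoff_sub_le hφ hM hM' ht.1 ht.2 hε.le hε1 x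
        _ ≤ A * exp (δ * ‖x‖ ^ 2) *
            (ε * M * ((L * exp (δ * ‖x‖ ^ 2)) * exp (-‖x‖ ^ 2 / (4 * (1 - s))))) := by
            gcongr
            exact hlin _ (norm_nonneg x)
        _ = ε * (A * M * L) * (exp (δ * ‖x‖ ^ 2) * exp (δ * ‖x‖ ^ 2) *
              exp (-(4 * δ) * ‖x‖ ^ 2)) := by rw [hexp]; ring
        _ = _ := by
            rw [hexp_add, hexp_add]
            ring_nf
  set ε : ℕ → ℝ := fun k ↦ 1 / ((k : ℝ) + 1) with hε
  have hεlim : Filter.Tendsto ε Filter.atTop (nhds 0) := tendsto_one_div_add_atTop_nhds_zero_nat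
  have hlim0 : Filter.Tendsto (fun k ↦ I (ε k) s) Filter.atTop (nhds 0) := by
    refine squeeze_zero_norm (fun k ↦ hbound (ε k) (by positivity) ?_)
      (by simpa using hεlim.mul_const (A * M * L * J * |s|))
    exact (div_le_one (by positivity)).2 (by simp)
  refine tendsto_nhds_unique ?_ hlim0
  have hus : Continuous (fun x ↦ u (x, s)) := hu.1.continuous.comp (by fun_prop)
  have hWs := (contDiff_backwardHeatKernel n s).continuous
  refine tendsto_integral_of_dominated_convergence
    (fun x ↦ A * exp (-(3 * δ) * ‖x‖ ^ 2)) (fun k ↦ ?_)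
    ((integrable_exp_neg_mul_sq_norm (by positivity)).const_mul _) (fun k ↦ .of_forall fun x ↦ ?_)
    (.of_forall fun x ↦ ?_)
  · exact (hus.mul (hWs.mul (φ.continuous.comp (by fun_prop)))).aestronglyMeasurable
  · rw [norm_mul, norm_mul, Real.norm_of_nonneg (backwardHeatKernel_nonneg n hs x),
      Real.norm_of_nonneg φ.nonneg]
    calc _ ≤ A * exp (δ * ‖x‖ ^ 2) * (exp (-(4 * δ) * ‖x‖ ^ 2) * 1) := by
          gcongr
          · exact mul_nonneg (backwardHeatKernel_nonneg n hs x) φ.nonneg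
          · exact hgr' x s le_rfl hs
          · exact φ.nonneg
          · exact (backwardHeatKernel_le n le_rfl hs x).trans_eq (hexp _)
          · exact φ.le_one
      _ = A * (exp (δ * ‖x‖ ^ 2) * exp (-(4 * δ) * ‖x‖ ^ 2)) := by ring
      _ = _ := by
          rw [hexp_add]
          ring_nf
  · have hφ1 : φ (0 : EuclideanSpace ℝ (Fin n)) = 1 :=
      φ.one_of_mem_closedBall (Metric.mem_closedBall_self zero_le_one)
    have h : Filter.Tendsto (fun k ↦ φ (ε k • x)) Filter.atTop (nhds 1) := by
      rw [← hφ1]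
      refine (φ.continuous.tendsto 0).comp ?_
      simpa using hεlim.smul_const x
    simpa using (h.const_mul (backwardHeatKernel n s x)).const_mul (u (x, s))

lemma IsAncientHeat.comp_add_right {n : ℕ} {u : EuclideanSpace ℝ (Fin n) × ℝ → ℝ}
    (hu : IsAncientHeat n u) (y : EuclideanSpace ℝ (Fin n)) :
    IsAncientHeat n (fun p ↦ u (p.1 + y, p.2)) := by
  refine ⟨hu.1.comp (by fun_prop), fun x t ht ↦ ?_⟩
  rw [← hu.2 (x + y) t ht]
  simp only [lap]
  refine Finset.sum_congr rfl fun i _ ↦ ?_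
  have h (z) : fderiv ℝ (fun z ↦ u (z + y, t)) z = fderiv ℝ (fun z ↦ u (z, t)) (z + y) :=
    fderiv_comp_add_right (f := fun z ↦ u (z, t)) y
  simp only [h]
  rw [fderiv_comp_add_right
    (f := fun z ↦ fderiv ℝ (fun z ↦ u (z, t)) z (EuclideanSpace.single i 1)) y]

lemma exists_mul_rpow_le_mul_exp_sq {c q a δ : ℝ} (hc : 0 ≤ c) (hq : 0 < q) (ha : 0 ≤ a)
    (hδ : 0 < δ) : ∃ A, ∀ r, 0 ≤ r → c * (r + a) ^ q ≤ A * exp (δ * r ^ 2) := by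
  refine ⟨c * (a + 1 / (4 * (δ / q)) + 1) ^ q, fun r hr ↦ ?_⟩
  have hδq : 0 < δ / q := by positivity
  calc c * (r + a) ^ q
      ≤ c * ((a + 1 / (4 * (δ / q)) + 1) * exp (δ / q * r ^ 2)) ^ q := by
        gcongr
        exact add_le_mul_exp_mul_sq ha hδq r
    _ = _ := by
        rw [mul_rpow (by positivity) (exp_nonneg _), ← exp_mul, ← mul_assoc,
          show δ / q * r ^ 2 * q = δ * r ^ 2 by field_simp]

/-- backward uniqueness: an ancient solution of the heat equation on
`ℝⁿ × (-∞,0]` of polynomial growth of degree at most `q ≥ 1` which vanishes at time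
`t = 0` vanishes identically on `ℝⁿ × (-∞,0]`. -/
theorem ancient_poly_growth_backward_uniqueness (n : ℕ) (q c₀ : ℝ)
    (hq : 1 ≤ q) (hc₀ : 0 < c₀)
    (u : EuclideanSpace ℝ (Fin n) × ℝ → ℝ)
    (hu : IsAncientHeat n u)
    (hgr : ∀ (x : EuclideanSpace ℝ (Fin n)) (t : ℝ), t ≤ 0 →
      |u (x, t)| ≤ c₀ * (‖x‖ + Real.sqrt |t| + 1) ^ q)
    (h0 : ∀ x : EuclideanSpace ℝ (Fin n), u (x, 0) = 0) :
    ∀ (x : EuclideanSpace ℝ (Fin n)) (t : ℝ), t ≤ 0 → u (x, t) = 0 := by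
  intro x s hs
  have hs1 : 0 < 1 - s := by linarith
  have hδ : 0 < 1 / (16 * (1 - s)) := by positivity
  have hbound (y : EuclideanSpace ℝ (Fin n)) : ∃ A, ∀ x t, s ≤ t → t ≤ 0 →
      |u (x + y, t)| ≤ A * exp (‖x‖ ^ 2 / (16 * (1 - s))) := by
    obtain ⟨A, hA⟩ := exists_mul_rpow_le_mul_exp_sq (a := ‖y‖ + √|s| + 1) hc₀.le
      (one_pos.trans_le hq) (by positivity) hδ
    refine ⟨A, fun x t hst ht ↦ (hgr _ t ht).trans ?_⟩
    rw [div_eq_mul_one_div, mul_comm (‖x‖ ^ 2)]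
    refine le_trans ?_ (hA ‖x‖ (norm_nonneg x))
    have h1 : |t| ≤ |s| := by
      rw [abs_of_nonpos ht, abs_of_nonpos hs]
      linarith
    have h2 := norm_add_le x y
    have h3 := Real.sqrt_le_sqrt h1
    refine mul_le_mul_of_nonneg_left (rpow_le_rpow (by positivity) (by linarith) (by linarith))
      hc₀.le
  have hzero (y : EuclideanSpace ℝ (Fin n)) :
      ∫ x, u (x, s) * backwardHeatKernel n s (x - y) = 0 := by
    obtain ⟨A, hA⟩ := hbound y
    have h := (hu.comp_add_right y).integral_mul_backwardHeatKernel_eq_zero hs hA fun _ ↦ h0 _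
    rw [← h, ← integral_add_right_eq_self _ y]
    simp
  set f : EuclideanSpace ℝ (Fin n) → ℝ := fun x ↦ u (x, s) * exp (-‖x‖ ^ 2 / (4 * (1 - s)))
    with hf
  have hus : Continuous (fun x ↦ u (x, s)) := hu.1.continuous.comp (by fun_prop)
  have hfc : Continuous f := hus.mul (by fun_prop)
  suffices h : f = 0 by simpa [hf, exp_ne_zero] using congrFun h x
  refine eq_zero_of_integral_mul_exp_inner_eq_zero hfc (fun y ↦ ?_) fun y ↦ ?_
  · obtain ⟨A, hA⟩ := hbound 0
    refine Integrable.mono' ((integrable_exp_neg_mul_sq_norm_add_inner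
      (show 0 < 3 / (16 * (1 - s)) by positivity) y).const_mul A)
      (hfc.mul (by fun_prop)).aestronglyMeasurable (.of_forall fun x ↦ ?_)
    have h := hA x s le_rfl hs
    rw [add_zero] at h
    rw [hf, norm_mul, norm_mul, norm_of_nonneg (exp_nonneg _), norm_of_nonneg (exp_nonneg _)]
    calc _ ≤ A * exp (‖x‖ ^ 2 / (16 * (1 - s))) * exp (-‖x‖ ^ 2 / (4 * (1 - s)))
          * exp (inner ℝ x y) := by
          gcongr
          exact h
      _ = _ := by
          rw [mul_assoc, mul_assoc, ← exp_add, ← exp_add, real_inner_comm]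
          congr 2
          field_simp
          ring
  · set K : ℝ := (1 - s) ^ (-(n : ℝ) / 2) * exp (-((1 - s) * ‖y‖ ^ 2)) with hK
    have hK0 : K ≠ 0 := by positivity
    refine (mul_eq_zero_iff_left hK0).1 ?_
    rw [← integral_const_mul, ← hzero ((2 * (1 - s)) • y)]
    congr 1 with x
    have h : -‖x - (2 * (1 - s)) • y‖ ^ 2 / (4 * (1 - s)) =
        -‖x‖ ^ 2 / (4 * (1 - s)) + inner ℝ x y + -((1 - s) * ‖y‖ ^ 2) := by
      rw [norm_sub_sq_real, norm_smul, inner_smul_right, norm_of_nonneg (by positivity)]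
      field_simp
      ring
    rw [backwardHeatKernel, h, exp_add, exp_add, hf, hK]
    ring
end
end
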